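/- arXiv:1510.08130 — 3 statements merged into one kernel-verified Lean document; each statement's English description precedes it below -/
import Mathlib

section
/- Let ζ ∈ 𝔻 and f ∈ H². Then D_ζ(f) := (2/(1−|ζ|²)) ∫_𝔻 log|(1 − conj(ζ)z)/(ζ − z)| · |f'(z)|² dA(z) equals (1/2π) ∫_𝕋 |(f(λ) − f(ζ))/(λ − ζ)|² |dλ|. In particular, for k_w the Cauchy kernel, D_ζ(k_w) = ‖(conj(w)/(1 − conj(w)ζ)) k_w‖²_{H²}. -/
open Complex Metric MeasureTheory Real Filter

lemma aux_orth (a : ℝ) (m n : ℕ) :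
    ∫ θ in a..(a + 2 * π), (circleMap 0 1 θ) ^ m * (starRingEnd ℂ) ((circleMap 0 1 θ) ^ n)
      = if m = n then (2 * π : ℂ) else 0 := by
  have h1 : ∀ θ : ℝ, (circleMap 0 1 θ) ^ m * (starRingEnd ℂ) ((circleMap 0 1 θ) ^ n)
      = cexp ((((m : ℂ) - n) * I) * θ) := by
    intro θ
    simp only [circleMap, zero_add, ofReal_one, one_mul]
    rw [← Complex.exp_nat_mul, ← Complex.exp_nat_mul, ← Complex.exp_conj, ← Complex.exp_add]
    congr 1
    simp
    ring
  simp_rw [h1]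
  split_ifs with h
  · subst h
    simp
  · have hc : ((m : ℂ) - n) * I ≠ 0 := by
      apply mul_ne_zero _ I_ne_zero
      rw [sub_ne_zero]
      exact_mod_cast h
    rw [integral_exp_mul_complex hc]
    have : cexp (((m : ℂ) - n) * I * ((a + 2 * π : ℝ) : ℂ)) = cexp (((m : ℂ) - n) * I * a) := by
      rw [Complex.exp_eq_exp_iff_exists_int]
      refine ⟨(m : ℤ) - n, ?_⟩
      push_cast
      ring
    rw [this]
    simp

lemma aux_parseval (a : ℝ) (c : ℕ → ℂ) (hc : Summable fun n => ‖c n‖) :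
    ∫ θ in a..(a + 2 * π), ‖∑' n, c n * (circleMap 0 1 θ) ^ n‖ ^ 2 = 2 * π * ∑' n, ‖c n‖ ^ 2 := by
  have hle : a ≤ a + 2 * π := by linarith [Real.pi_pos]
  have hnorm : ∀ (θ : ℝ) (n : ℕ), ‖c n * (circleMap 0 1 θ) ^ n‖ = ‖c n‖ := by
    intro θ n; simp
  have hs : ∀ θ : ℝ, Summable fun n => ‖c n * (circleMap 0 1 θ) ^ n‖ := by
    intro θ; simpa only [hnorm] using hc
  set G : ℕ × ℕ → ℝ → ℂ := fun p θ => (c p.1 * (circleMap 0 1 θ) ^ p.1) *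
    (starRingEnd ℂ) (c p.2 * (circleMap 0 1 θ) ^ p.2) with hG
  have hsum2 : Summable fun p : ℕ × ℕ => ‖c p.1‖ * ‖c p.2‖ :=
    Summable.mul_of_nonneg hc hc (fun _ => norm_nonneg _) (fun _ => norm_nonneg _)
  have hpt : ∀ θ : ℝ, ((‖∑' n, c n * (circleMap 0 1 θ) ^ n‖ ^ 2 : ℝ) : ℂ) = ∑' p, G p θ := by
    intro θ
    rw [← Complex.normSq_eq_norm_sq, ← Complex.mul_conj, Complex.conj_tsum]
    rw [tsum_mul_tsum_of_summable_norm (hs θ) (by simpa only [RCLike.norm_conj] using hs θ)]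
  have hGn : ∀ p θ, ‖G p θ‖ = ‖c p.1‖ * ‖c p.2‖ := by
    intro p θ
    simp only [hG, norm_mul, RCLike.norm_conj, norm_pow]
    simp
  have hcont : ∀ p, Continuous (G p) := by
    intro p
    have := continuous_circleMap 0 1
    simp only [hG]
    fun_prop
  have hint : ∀ p, Integrable (G p) (volume.restrict (Set.Ioc a (a + 2 * π))) := fun p =>
    ((hcont p).intervalIntegrable a (a + 2 * π)).1
  have key := hasSum_integral_of_summable_integral_norm hint (by
    simp only [hGn]
    simpa using hsum2.mul_left _)
  have hval : ∀ p, ∫ θ in Set.Ioc a (a + 2 * π), G p θ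
      = if p.1 = p.2 then (2 * π * ((‖c p.1‖ ^ 2 : ℝ) : ℂ) : ℂ) else 0 := by
    intro p
    rw [← intervalIntegral.integral_of_le hle]
    have : ∀ θ, G p θ = (c p.1 * (starRingEnd ℂ) (c p.2)) *
      ((circleMap 0 1 θ) ^ p.1 * (starRingEnd ℂ) ((circleMap 0 1 θ) ^ p.2)) := by
      intro θ; simp only [hG, map_mul]; ring
    simp_rw [this]
    rw [intervalIntegral.integral_const_mul, aux_orth]
    split_ifs with h
    · rw [← h, Complex.mul_conj, Complex.normSq_eq_norm_sq]; ring
    · simp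
  simp_rw [hval] at key
  have hinj : Function.Injective (fun n : ℕ => ((n, n) : ℕ × ℕ)) := by
    intro x y h; simpa using h
  have key2 := (hinj.hasSum_iff (f := fun p : ℕ × ℕ => if p.1 = p.2 then (2 * π * ((‖c p.1‖ ^ 2 : ℝ) : ℂ) : ℂ) else 0) (by
    rintro ⟨x, y⟩ hxy
    simp only [Set.mem_range, Prod.mk.injEq, not_exists, not_and] at hxy
    simp only [ite_eq_right_iff]
    intro h
    exact absurd h (hxy x rfl))).2 key
  have key3 := key2.tsum_eq
  simp only [Function.comp_def, if_true] at key3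
  simp_rw [← hpt] at key3
  rw [tsum_mul_left, integral_complex_ofReal, ← intervalIntegral.integral_of_le hle,
    ← Complex.ofReal_tsum] at key3
  exact_mod_cast key3.symm

lemma aux_cont (c : ℕ → ℂ) (hc : Summable fun n => ‖c n‖) :
    Continuous fun θ : ℝ => ∑' n, c n * (circleMap 0 1 θ) ^ n := by
  refine continuous_tsum (u := fun n => ‖c n‖) ?_ hc ?_
  · intro n
    have := continuous_circleMap 0 1
    fun_prop
  · intro n x; simp

lemma aux_lparseval (a : ℝ) (c : ℕ → ℂ) (hc : Summable fun n => ‖c n‖) :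
    ∫⁻ θ in Set.Ioc a (a + 2 * π), ‖∑' n, c n * (circleMap 0 1 θ) ^ n‖ₑ ^ 2
      = ENNReal.ofReal (2 * π) * ∑' n, ‖c n‖ₑ ^ 2 := by
  have hle : a ≤ a + 2 * π := by linarith [Real.pi_pos]
  have hen : ∀ z : ℂ, ‖z‖ₑ ^ 2 = ENNReal.ofReal (‖z‖ ^ 2) := by
    intro z; rw [ENNReal.ofReal_pow (norm_nonneg _), ofReal_norm]
  have hsq : Summable fun n => ‖c n‖ ^ 2 := by
    have := Summable.mul_of_nonneg hc hc (fun _ => norm_nonneg _) (fun _ => norm_nonneg _)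
    have h2 := this.comp_injective (i := fun n : ℕ => ((n, n) : ℕ × ℕ))
      (by intro x y h; simpa using h)
    simpa [Function.comp_def, sq] using h2
  simp_rw [hen]
  rw [← ENNReal.ofReal_tsum_of_nonneg (fun _ => by positivity) hsq,
    ← ENNReal.ofReal_mul (by positivity), ← aux_parseval a c hc,
    intervalIntegral.integral_of_le hle, ofReal_integral_eq_lintegral_ofReal]
  · exact (((aux_cont c hc).norm.pow 2).intervalIntegrable a (a + 2 * π)).1
  · exact Eventually.of_forall fun _ => by positivity

lemma aux_moment (n : ℕ) :
    ∫⁻ r in Set.Ioo (0 : ℝ) 1, ENNReal.ofReal (r ^ (2 * n + 1) * (-Real.log r))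
      = ENNReal.ofReal (1 / (4 * ((n : ℝ) + 1) ^ 2)) := by
  set m : ℝ := 2 * n + 2 with hm
  have hm0 : 0 < m := by positivity
  set A : ℝ → ℝ := fun r => r ^ (2 * n + 2) * (1 / m ^ 2) - r ^ (2 * n + 1) * (r * Real.log r) * (1 / m) with hA
  have hcont : ContinuousOn A (Set.Icc 0 1) := by
    have := Real.continuous_mul_log
    apply Continuous.continuousOn
    fun_prop
  have hder : ∀ x ∈ Set.Ioo (0 : ℝ) 1, HasDerivAt A (x ^ (2 * n + 1) * (-Real.log x)) x := by
    intro x hx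
    have hx0 : x ≠ 0 := hx.1.ne'
    have h1 := (hasDerivAt_pow (2 * n + 2) x).mul_const (1 / m ^ 2)
    have h2 := (((hasDerivAt_pow (2 * n + 1) x).mul (Real.hasDerivAt_mul_log hx0))).mul_const (1 / m)
    refine HasDerivAt.congr_deriv (f := A) (h1.sub h2) ?_
    push_cast
    have : (2 * n + 2 : ℝ) = m := rfl
    rw [this, show (2 * n + 1 : ℝ) = m - 1 by rw [hm]; ring, pow_succ x (2 * n)]
    field_simp
    ring
  have hpos : ∀ x ∈ Set.Ioo (0 : ℝ) 1, 0 ≤ x ^ (2 * n + 1) * (-Real.log x) := by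
    intro x hx
    exact mul_nonneg (pow_nonneg hx.1.le _) (by linarith [Real.log_nonpos hx.1.le hx.2.le])
  have hi := intervalIntegral.integrableOn_deriv_of_nonneg hcont hder hpos
  have hv := intervalIntegral.integral_eq_sub_of_hasDerivAt_of_le zero_le_one hcont hder
    ((intervalIntegrable_iff_integrableOn_Ioc_of_le zero_le_one).2 hi)
  rw [intervalIntegral.integral_of_le zero_le_one, integral_Ioc_eq_integral_Ioo] at hv
  rw [← ofReal_integral_eq_lintegral_ofReal (hi.mono_set Set.Ioo_subset_Ioc_self), hv]
  · congr 1
    simp [hA, hm]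
    field_simp
    ring
  · exact (ae_restrict_iff' measurableSet_Ioo).2 (Eventually.of_forall hpos)

lemma aux_taylor (R : ℝ) (hR : 1 < R) (g : ℂ → ℂ) (hg : DifferentiableOn ℂ g (ball 0 R)) :
    (Summable fun n : ℕ => ‖iteratedDeriv n g 0 / (n.factorial : ℂ)‖) ∧
    ∀ z : ℂ, ‖z‖ < R → g z = ∑' n : ℕ, iteratedDeriv n g 0 / (n.factorial : ℂ) * z ^ n := by
  have h : ∀ z : ℂ, ‖z‖ < R →
      HasSum (fun n : ℕ => iteratedDeriv n g 0 / (n.factorial : ℂ) * z ^ n) (g z) := by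
    intro z hz
    have := Complex.hasSum_taylorSeries_on_ball hg (z := z) (by simpa using hz)
    have e : (fun n : ℕ => iteratedDeriv n g 0 / (n.factorial : ℂ) * z ^ n) =
        fun n : ℕ => ((n.factorial : ℂ))⁻¹ • (z - 0) ^ n • iteratedDeriv n g 0 := by
      funext n
      simp only [smul_eq_mul, sub_zero]
      ring
    rw [e]
    exact this
  refine ⟨?_, fun z hz => (h z hz).tsum_eq.symm⟩
  have := (h 1 (by simpa using hR)).summable.norm
  simpa using this

/-- Littlewood–Paley at the origin. -/
lemma aux_LP (R : ℝ) (hR : 1 < R) (g : ℂ → ℂ) (hg : DifferentiableOn ℂ g (ball 0 R)) :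
    ∫⁻ z in ball (0 : ℂ) 1, ENNReal.ofReal (Real.log ‖z⁻¹‖) * ‖deriv g z‖ₑ ^ 2
      = ENNReal.ofReal (1 / 4) * ∫⁻ θ in Set.Ioc (0 : ℝ) (2 * π), ‖g (circleMap 0 1 θ) - g 0‖ₑ ^ 2 := by
  obtain ⟨hs, ht⟩ := aux_taylor R hR g hg
  obtain ⟨hs', ht'⟩ := aux_taylor R hR (deriv g) (hg.deriv isOpen_ball)
  set c : ℕ → ℂ := fun n => iteratedDeriv n g 0 / (n.factorial : ℂ) with hc
  set d : ℕ → ℂ := fun n => iteratedDeriv n (deriv g) 0 / (n.factorial : ℂ) with hd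
  replace hs : Summable fun n => ‖c n‖ := hs
  replace hs' : Summable fun n => ‖d n‖ := hs'
  have hdc : ∀ n, d n = (n + 1) * c (n + 1) := by
    intro n
    simp only [hc, hd]
    rw [iteratedDeriv_succ', Nat.factorial_succ]
    have : (n.factorial : ℂ) ≠ 0 := by exact_mod_cast n.factorial_ne_zero
    have h2 : (n + 1 : ℂ) ≠ 0 := by exact_mod_cast n.succ_ne_zero
    push_cast
    field_simp
  -- boundary side
  have hB : ∫⁻ θ in Set.Ioc (0 : ℝ) (2 * π), ‖g (circleMap 0 1 θ) - g 0‖ₑ ^ 2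
      = ENNReal.ofReal (2 * π) * ∑' n, ‖c (n + 1)‖ₑ ^ 2 := by
    have h0 : ∀ θ, g (circleMap 0 1 θ) - g 0 =
        ∑' n, (if n = 0 then 0 else c n) * (circleMap 0 1 θ) ^ n := by
      intro θ
      have hsum : Summable fun n => c n * (circleMap 0 1 θ) ^ n := by
        apply Summable.of_norm
        simpa using hs
      have e1 := ht (circleMap 0 1 θ) (by simpa using hR)
      rw [hsum.tsum_eq_zero_add] at e1
      have e2 : Summable fun n => (if n = 0 then 0 else c n) * (circleMap 0 1 θ) ^ n := by
        apply Summable.of_norm_bounded hs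
        intro n
        split_ifs <;> simp
      rw [e2.tsum_eq_zero_add, e1]
      simp [hc]
    simp_rw [h0]
    have hs2 : Summable fun n => ‖(if n = 0 then 0 else c n)‖ := by
      apply Summable.of_nonneg_of_le (fun _ => norm_nonneg _) _ hs
      intro n
      split_ifs <;> simp
    have := aux_lparseval 0 _ hs2
    rw [zero_add] at this
    rw [this, tsum_eq_zero_add' ENNReal.summable]
    simp
  rw [hB]
  -- area side
  rw [← lintegral_indicator measurableSet_ball, ← Complex.lintegral_comp_polarCoord_symm]
  have hpol : ∀ p : ℝ × ℝ, Complex.polarCoord.symm p = (p.1 : ℂ) * circleMap 0 1 p.2 := by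
    intro p
    rw [Complex.polarCoord_symm_apply]
    simp [circleMap, Complex.exp_mul_I]
  rw [polarCoord_target]
  have hrw : ∫⁻ p in (Set.Ioi (0 : ℝ) ×ˢ Set.Ioo (-π) π), ENNReal.ofReal p.1 •
      (ball (0 : ℂ) 1).indicator (fun z => ENNReal.ofReal (Real.log ‖z⁻¹‖) * ‖deriv g z‖ₑ ^ 2)
        (Complex.polarCoord.symm p)
      = ∫⁻ p in (Set.Ioi (0 : ℝ) ×ˢ Set.Ioo (-π) π), ENNReal.ofReal p.1 *
    ((Set.Ioo (0:ℝ) 1).indicator (fun r => ENNReal.ofReal (-Real.log r)) p.1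
      * ‖deriv g ((p.1 : ℂ) * circleMap 0 1 p.2)‖ₑ ^ 2) := by
    apply setLIntegral_congr_fun (measurableSet_Ioi.prod measurableSet_Ioo)
    rintro ⟨r, θ⟩ ⟨hr, hθ⟩
    simp only [Set.mem_Ioi] at hr
    simp only [hpol, smul_eq_mul]
    congr 1
    by_cases h1 : r < 1
    · rw [Set.indicator_of_mem (by simpa [abs_of_pos hr] using h1),
        Set.indicator_of_mem (show r ∈ Set.Ioo (0:ℝ) 1 from ⟨hr, h1⟩)]
      simp [abs_of_pos hr]
    · rw [Set.indicator_of_notMem (by simpa [abs_of_pos hr] using h1),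
        Set.indicator_of_notMem (by simp [h1])]
      simp
  rw [hrw, Measure.volume_eq_prod, ← Measure.prod_restrict, lintegral_prod]
  swap
  · apply Measurable.aemeasurable
    have h1 : Measurable (deriv g) := measurable_deriv g
    have h2 : Continuous (circleMap 0 1) := continuous_circleMap 0 1
    have h3 : Measurable fun p : ℝ × ℝ => (p.1 : ℂ) * circleMap 0 1 p.2 := by
      apply Continuous.measurable; fun_prop
    have h4 : Measurable ((Set.Ioo (0:ℝ) 1).indicator (fun r => ENNReal.ofReal (-Real.log r))) := by
      apply Measurable.indicator _ measurableSet_Ioo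
      fun_prop
    exact (measurable_fst.ennreal_ofReal).mul ((h4.comp measurable_fst).mul ((h1.comp h3).enorm.pow_const 2))
  -- inner integral
  have hin : ∀ r ∈ Set.Ioi (0 : ℝ), ∫⁻ θ in Set.Ioo (-π) π, ENNReal.ofReal r *
      ((Set.Ioo (0:ℝ) 1).indicator (fun r => ENNReal.ofReal (-Real.log r)) r
      * ‖deriv g ((r : ℂ) * circleMap 0 1 θ)‖ₑ ^ 2)
      = (Set.Ioo (0:ℝ) 1).indicator (fun r => ∑' n, (ENNReal.ofReal (2 * π) * ‖d n‖ₑ ^ 2) *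
        ENNReal.ofReal (r ^ (2 * n + 1) * (-Real.log r))) r := by
    intro r hr
    simp only [Set.mem_Ioi] at hr
    by_cases h1 : r < 1
    · have hmem : r ∈ Set.Ioo (0:ℝ) 1 := ⟨hr, h1⟩
      rw [Set.indicator_of_mem hmem, Set.indicator_of_mem hmem]
      simp_rw [← mul_assoc]
      rw [lintegral_const_mul' _ _ (by finiteness)]
      have e1 : ∀ θ, deriv g ((r : ℂ) * circleMap 0 1 θ)
          = ∑' n, (d n * r ^ n) * (circleMap 0 1 θ) ^ n := by
        intro θ
        rw [ht' _ (by simp [abs_of_pos hr]; linarith)]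
        simp_rw [mul_pow, ← mul_assoc]
        rfl
      simp_rw [e1]
      have hsr : Summable fun n => ‖d n * (r : ℂ) ^ n‖ := by
        apply Summable.of_nonneg_of_le (fun _ => norm_nonneg _) _ hs'
        intro n
        rw [norm_mul, norm_pow]
        apply mul_le_of_le_one_right (norm_nonneg _)
        apply pow_le_one₀ (norm_nonneg _)
        simp [abs_of_pos hr, h1.le]
      have := aux_lparseval (-π) _ hsr
      rw [show -π + 2 * π = π by ring, ← restrict_Ioo_eq_restrict_Ioc] at this
      rw [this, ← ENNReal.tsum_mul_left, ← ENNReal.tsum_mul_left]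
      congr 1
      ext n
      rw [enorm_mul, pow_succ r, mul_pow, mul_assoc (r ^ (2 * n)),
        ENNReal.ofReal_mul (p := r ^ (2 * n)) (by positivity), ENNReal.ofReal_mul (p := r) hr.le]
      have : ‖(r : ℂ) ^ n‖ₑ ^ 2 = ENNReal.ofReal (r ^ (2 * n)) := by
        rw [← ofReal_norm, ← ENNReal.ofReal_pow (norm_nonneg _)]
        congr 1
        rw [norm_pow, ← pow_mul, mul_comm n]
        simp [abs_of_pos hr]
      rw [this]
      ring
    · rw [Set.indicator_of_notMem (by simp [h1]), Set.indicator_of_notMem (by simp [h1])]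
      simp
  rw [setLIntegral_congr_fun measurableSet_Ioi hin, setLIntegral_indicator measurableSet_Ioo,
    Set.inter_eq_left.2 (fun x hx => hx.1), lintegral_tsum]
  swap
  · intro n
    fun_prop
  rw [← ENNReal.tsum_mul_left, ← ENNReal.tsum_mul_left]
  congr 1
  ext n
  rw [lintegral_const_mul' _ _ (by finiteness), aux_moment, hdc, ← ofReal_norm, ← ofReal_norm,
    ← ENNReal.ofReal_pow (norm_nonneg _), ← ENNReal.ofReal_pow (norm_nonneg _),
    ← ENNReal.ofReal_mul (by positivity), ← ENNReal.ofReal_mul (by positivity),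
    ← ENNReal.ofReal_mul (by positivity), ← ENNReal.ofReal_mul (by positivity)]
  congr 1
  rw [norm_mul]
  have : ‖(n + 1 : ℂ)‖ = n + 1 := by
    have := Complex.norm_natCast (n + 1)
    push_cast at this
    exact this
  rw [this]
  field_simp

lemma aux_kernel (w : ℂ) (hw : ‖w‖ < 1) :
    ∫ θ in (0 : ℝ)..(2 * π), ‖(1 - (starRingEnd ℂ) w * circleMap 0 1 θ)⁻¹‖ ^ 2
      = 2 * π * (1 - ‖w‖ ^ 2)⁻¹ := by
  have hs : Summable fun n : ℕ => ‖((starRingEnd ℂ) w) ^ n‖ := by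
    simp only [norm_pow, RCLike.norm_conj]
    exact summable_geometric_of_lt_one (norm_nonneg _) hw
  have h := aux_parseval 0 _ hs
  rw [zero_add] at h
  have e1 : ∀ θ : ℝ, ∑' n : ℕ, ((starRingEnd ℂ) w) ^ n * circleMap 0 1 θ ^ n
      = (1 - (starRingEnd ℂ) w * circleMap 0 1 θ)⁻¹ := by
    intro θ
    simp_rw [← mul_pow]
    apply tsum_geometric_of_norm_lt_one
    simpa using hw
  simp_rw [e1] at h
  rw [h]
  congr 1
  simp_rw [norm_pow, RCLike.norm_conj, ← pow_mul, mul_comm _ 2, pow_mul]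
  apply tsum_geometric_of_lt_one (by positivity)
  exact pow_lt_one₀ (norm_nonneg _) hw two_ne_zero

lemma aux_den (ζ u : ℂ) (hζ : ‖ζ‖ < 1) (hu : ‖u‖ ≤ 1) : 1 - (starRingEnd ℂ) ζ * u ≠ 0 := by
  intro h
  have h1 : (starRingEnd ℂ) ζ * u = 1 := by linear_combination -h
  have h2 : ‖ζ‖ * ‖u‖ = 1 := by
    have := congrArg norm h1
    simpa using this
  nlinarith [norm_nonneg ζ, norm_nonneg u]

/-- The disc automorphism exchanging `0` and `ζ`. -/
noncomputable def mob (ζ u : ℂ) : ℂ := (ζ - u) / (1 - (starRingEnd ℂ) ζ * u)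

lemma mob_one_sub (ζ u : ℂ) (hζ : ‖ζ‖ < 1) (hu : 1 - (starRingEnd ℂ) ζ * u ≠ 0) :
    1 - (starRingEnd ℂ) ζ * mob ζ u ≠ 0 ∧ mob ζ (mob ζ u) = u := by
  have hz : (1 - (starRingEnd ℂ) ζ * ζ) ≠ 0 := aux_den ζ ζ hζ hζ.le
  have h1 : 1 - (starRingEnd ℂ) ζ * mob ζ u
      = (1 - (starRingEnd ℂ) ζ * ζ) / (1 - (starRingEnd ℂ) ζ * u) := by
    unfold mob
    field_simp
    ring
  have h2 : 1 - (starRingEnd ℂ) ζ * mob ζ u ≠ 0 := by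
    rw [h1]; exact div_ne_zero hz hu
  refine ⟨h2, ?_⟩
  rw [mob, div_eq_iff h2, h1]
  have hu' : (1 - (starRingEnd ℂ) ζ * u) * (1 - (starRingEnd ℂ) ζ * u)⁻¹ = 1 := mul_inv_cancel₀ hu
  rw [mob, div_eq_mul_inv, div_eq_mul_inv]
  linear_combination (-ζ) * hu'

lemma mob_normSq (ζ u : ℂ) :
    ‖1 - (starRingEnd ℂ) ζ * u‖ ^ 2 - ‖ζ - u‖ ^ 2 = (1 - ‖ζ‖ ^ 2) * (1 - ‖u‖ ^ 2) := by
  simp only [← Complex.normSq_eq_norm_sq, Complex.normSq_apply]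
  simp
  ring

lemma mob_norm_lt (ζ u : ℂ) (hζ : ‖ζ‖ < 1) (hu : ‖u‖ < 1) : ‖mob ζ u‖ < 1 := by
  have h := mob_normSq ζ u
  have hd := norm_pos_iff.2 (aux_den ζ u hζ hu.le)
  have : 0 < (1 - ‖ζ‖ ^ 2) * (1 - ‖u‖ ^ 2) := by
    apply mul_pos <;> nlinarith [norm_nonneg ζ, norm_nonneg u]
  rw [mob, norm_div, div_lt_one hd]
  apply lt_of_pow_lt_pow_left₀ 2 hd.le
  linarith

lemma mob_norm_eq (ζ u : ℂ) (hζ : ‖ζ‖ < 1) (hu : ‖u‖ = 1) : ‖mob ζ u‖ = 1 := by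
  have h := mob_normSq ζ u
  have hd := norm_pos_iff.2 (aux_den ζ u hζ hu.le)
  rw [hu] at h
  rw [mob, norm_div, div_eq_one_iff_eq hd.ne']
  rw [← sq_eq_sq₀ (norm_nonneg _) (norm_nonneg _)]
  linarith

lemma mob_hasDerivAt (ζ u : ℂ) (hu : 1 - (starRingEnd ℂ) ζ * u ≠ 0) :
    HasDerivAt (mob ζ) (-(1 - (starRingEnd ℂ) ζ * ζ) / (1 - (starRingEnd ℂ) ζ * u) ^ 2) u := by
  have h1 : HasDerivAt (fun u : ℂ => ζ - u) (-1) u := by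
    simpa using (hasDerivAt_id u).const_sub ζ
  have h2 : HasDerivAt (fun u : ℂ => 1 - (starRingEnd ℂ) ζ * u) (-((starRingEnd ℂ) ζ)) u := by
    simpa using ((hasDerivAt_id u).const_mul ((starRingEnd ℂ) ζ)).const_sub 1
  refine HasDerivAt.congr_deriv (f := mob ζ) (h1.div h2 hu) ?_
  ring

/-- The Poisson kernel. -/
noncomputable def pois (ζ : ℂ) (θ : ℝ) : ℝ := (1 - ‖ζ‖ ^ 2) / ‖circleMap 0 1 θ - ζ‖ ^ 2

lemma circ_sub_ne (ζ : ℂ) (hζ : ‖ζ‖ < 1) (θ : ℝ) : circleMap 0 1 θ - ζ ≠ 0 := by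
  intro h
  rw [sub_eq_zero] at h
  rw [← h] at hζ
  simp at hζ

lemma pois_continuous (ζ : ℂ) (hζ : ‖ζ‖ < 1) : Continuous (pois ζ) := by
  unfold pois
  have := continuous_circleMap 0 1
  refine Continuous.div (by fun_prop) (by fun_prop) ?_
  intro θ
  exact pow_ne_zero _ (norm_ne_zero_iff.2 (circ_sub_ne ζ hζ θ))

lemma pois_integral (ζ : ℂ) (hζ : ‖ζ‖ < 1) : ∫ θ in (0 : ℝ)..(2 * π), pois ζ θ = 2 * π := by
  have h := aux_kernel ζ hζ
  have hz : (1 - ‖ζ‖ ^ 2) ≠ 0 := by nlinarith [norm_nonneg ζ]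
  have e : ∀ θ : ℝ, pois ζ θ
      = (1 - ‖ζ‖ ^ 2) * ‖(1 - (starRingEnd ℂ) ζ * circleMap 0 1 θ)⁻¹‖ ^ 2 := by
    intro θ
    have := mob_normSq ζ (circleMap 0 1 θ)
    simp only [norm_circleMap_zero, abs_one, one_pow, sub_self, mul_zero] at this
    unfold pois
    rw [norm_inv, inv_pow, ← div_eq_mul_inv, norm_sub_rev]
    congr 1
    linarith
  simp_rw [e]
  rw [intervalIntegral.integral_const_mul, h]
  field_simp

lemma mob_circle (ζ : ℂ) (hζ : ‖ζ‖ < 1) (V : ℂ → ℝ)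
    (hV : Continuous fun θ : ℝ => V (circleMap 0 1 θ)) :
    ∫ θ in (0 : ℝ)..(2 * π), V (mob ζ (circleMap 0 1 θ)) * pois ζ θ
      = ∫ θ in (0 : ℝ)..(2 * π), V (circleMap 0 1 θ) := by
  set a := arg (mob ζ 1) with ha
  set ψ : ℝ → ℝ := fun θ => a + ∫ t in (0 : ℝ)..θ, pois ζ t with hψ
  have hψd : ∀ θ, HasDerivAt ψ (pois ζ θ) θ := by
    intro θ
    have := intervalIntegral.integral_hasDerivAt_right
      ((pois_continuous ζ hζ).intervalIntegrable 0 θ)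
      ((pois_continuous ζ hζ).stronglyMeasurableAtFilter _ _) (pois_continuous ζ hζ).continuousAt
    exact this.const_add a
  set E : ℝ → ℂ := fun θ => mob ζ (circleMap 0 1 θ) * cexp (-(ψ θ * I)) with hE
  have hEd : ∀ θ, HasDerivAt E 0 θ := by
    intro θ
    have hden := aux_den ζ (circleMap 0 1 θ) hζ (by simp)
    have h1 := (mob_hasDerivAt ζ _ hden).comp θ (hasDerivAt_circleMap 0 1 θ)
    have h2 : HasDerivAt (fun θ => cexp (-(ψ θ * I))) (cexp (-(ψ θ * I)) * (-(pois ζ θ * I))) θ :=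
      (((hψd θ).ofReal_comp.mul_const I).neg).cexp
    refine HasDerivAt.congr_deriv (f := E) (h1.mul h2) ?_
    have hl : circleMap 0 1 θ * (starRingEnd ℂ) (circleMap 0 1 θ) = 1 := by
      rw [Complex.mul_conj, Complex.normSq_eq_norm_sq]; simp
    have hne := circ_sub_ne ζ hζ θ
    have hp : (pois ζ θ : ℂ) = (1 - (starRingEnd ℂ) ζ * ζ) /
        ((circleMap 0 1 θ - ζ) * ((starRingEnd ℂ) (circleMap 0 1 θ) - (starRingEnd ℂ) ζ)) := by
      unfold pois
      rw [← map_sub, Complex.mul_conj, mul_comm _ ζ, Complex.mul_conj,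
        Complex.normSq_eq_norm_sq, Complex.normSq_eq_norm_sq]
      push_cast
      rfl
    have hne2 : (starRingEnd ℂ) (circleMap 0 1 θ) - (starRingEnd ℂ) ζ ≠ 0 := by
      rw [← map_sub]; exact (map_ne_zero _).2 hne
    have key : -(1 - (starRingEnd ℂ) ζ * ζ) / (1 - (starRingEnd ℂ) ζ * circleMap 0 1 θ) ^ 2 *
        circleMap 0 1 θ = pois ζ θ * mob ζ (circleMap 0 1 θ) := by
      rw [hp, mob]
      generalize circleMap 0 1 θ = l at *
      generalize (starRingEnd ℂ) l = l' at *
      generalize (starRingEnd ℂ) ζ = z' at *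
      rw [div_mul_eq_mul_div, div_mul_div_comm, div_eq_div_iff (by positivity) (by positivity)]
      linear_combination (-(1 - z' * ζ) * (l - ζ) * (1 - z' * l)) * hl
    simp only [Function.comp_apply]
    linear_combination (I * cexp (-(ψ θ * I))) * key
  have hEc : ∀ θ, E θ = E 0 := fun θ =>
    is_const_of_deriv_eq_zero (fun x => (hEd x).differentiableAt) (fun x => (hEd x).deriv) θ 0
  have hE0 : E 0 = 1 := by
    have h0 : ψ 0 = a := by simp [hψ]
    have h1 := Complex.norm_mul_exp_arg_mul_I (mob ζ 1)
    rw [mob_norm_eq ζ 1 hζ (by simp), ofReal_one, one_mul] at h1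
    have h2 : circleMap 0 1 0 = 1 := by simp [circleMap]
    simp only [hE, h0, h2]
    rw [← h1, ← Complex.exp_add]
    simp [ha]
  have hlift : ∀ θ, mob ζ (circleMap 0 1 θ) = circleMap 0 1 (ψ θ) := by
    intro θ
    have h1 := (hEc θ).trans hE0
    simp only [hE, Complex.exp_neg] at h1
    rw [mul_inv_eq_one₀ (Complex.exp_ne_zero _)] at h1
    rw [h1]; simp [circleMap]
  simp_rw [hlift]
  have h := intervalIntegral.integral_comp_mul_deriv (a := 0) (b := 2 * π) (f := ψ) (f' := pois ζ)
    (g := fun θ => V (circleMap 0 1 θ)) (fun x _ => hψd x) (pois_continuous ζ hζ).continuousOn hV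
  simp only [Function.comp_def] at h
  rw [h]
  have e0 : ψ 0 = a := by simp [hψ]
  have e1 : ψ (2 * π) = a + 2 * π := by simp only [hψ, pois_integral ζ hζ]
  rw [e0, e1]
  have hper : Function.Periodic (fun θ => V (circleMap 0 1 θ)) (2 * π) := by
    intro θ
    simp only [periodic_circleMap 0 1 θ]
  have := hper.intervalIntegral_add_eq a 0
  rw [zero_add] at this
  exact this

lemma complex_det (c : ℂ) :
    |((ContinuousLinearMap.restrictScalars ℝ
      (ContinuousLinearMap.toSpanSingleton ℂ c : ℂ →L[ℂ] ℂ)) : ℂ →L[ℝ] ℂ).det| = ‖c‖ ^ 2 := by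
  rw [ContinuousLinearMap.det]
  have : ((ContinuousLinearMap.restrictScalars ℝ
      (ContinuousLinearMap.toSpanSingleton ℂ c : ℂ →L[ℂ] ℂ)) : ℂ →ₗ[ℝ] ℂ)
      = Algebra.lmul ℝ ℂ c := by
    ext <;> simp [mul_comm]
  rw [this, ← Algebra.norm_apply, Algebra.norm_complex_apply, Complex.normSq_eq_norm_sq,
    abs_of_nonneg (by positivity)]

lemma aux_base (ζ : ℂ) (hζ : ‖ζ‖ < 1) (R : ℝ) (hR : 1 < R) (h : ℂ → ℂ)
    (hh : DifferentiableOn ℂ h (ball 0 R)) :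
    ∫⁻ z in ball (0 : ℂ) 1, ENNReal.ofReal (Real.log ‖(1 - (starRingEnd ℂ) ζ * z) / (ζ - z)‖) *
        ‖deriv h z‖ₑ ^ 2
      = ENNReal.ofReal ((1 - ‖ζ‖ ^ 2) / 4) * ∫⁻ θ in Set.Ioc (0 : ℝ) (2 * π),
          ‖(h (circleMap 0 1 θ) - h ζ) / (circleMap 0 1 θ - ζ)‖ₑ ^ 2 := by
  have hz1 : 0 < 1 - ‖ζ‖ ^ 2 := by nlinarith [norm_nonneg ζ]
  -- extend past the closed disc
  obtain ⟨R', hR', hsub⟩ : ∃ R' : ℝ, 1 < R' ∧ ∀ u ∈ ball (0 : ℂ) R',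
      1 - (starRingEnd ℂ) ζ * u ≠ 0 ∧ mob ζ u ∈ ball (0 : ℂ) R := by
    have hopen : IsOpen {u : ℂ | 1 - (starRingEnd ℂ) ζ * u ≠ 0 ∧ ‖ζ - u‖ < R * ‖1 - (starRingEnd ℂ) ζ * u‖} := by
      apply IsOpen.inter
      · exact isOpen_ne_fun (f := fun u : ℂ => 1 - (starRingEnd ℂ) ζ * u) (g := fun _ => 0) (by fun_prop) (by fun_prop)
      · exact isOpen_lt (f := fun u : ℂ => ‖ζ - u‖) (g := fun u : ℂ => R * ‖1 - (starRingEnd ℂ) ζ * u‖)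
          (by fun_prop) (by fun_prop)
    obtain ⟨δ, hδ, hs⟩ := (isCompact_closedBall (0 : ℂ) 1).exists_thickening_subset_open hopen (by
      intro u hu
      have hu1 : ‖u‖ ≤ 1 := by simpa using hu
      have hd := aux_den ζ u hζ hu1
      refine ⟨hd, ?_⟩
      have h1 := mob_normSq ζ u
      have hd' := norm_pos_iff.2 hd
      have : 0 ≤ (1 - ‖ζ‖ ^ 2) * (1 - ‖u‖ ^ 2) := by
        apply mul_nonneg <;> nlinarith [norm_nonneg ζ, norm_nonneg u]
      have : ‖ζ - u‖ ≤ ‖1 - (starRingEnd ℂ) ζ * u‖ := by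
        apply le_of_sq_le_sq _ hd'.le
        linarith
      nlinarith)
    rw [thickening_closedBall hδ zero_le_one] at hs
    refine ⟨δ + 1, by linarith, fun u hu => ?_⟩
    obtain ⟨h1, h2⟩ := hs hu
    refine ⟨h1, ?_⟩
    rw [mem_ball_zero_iff, mob, norm_div, div_lt_iff₀ (norm_pos_iff.2 h1)]
    exact h2
  set g : ℂ → ℂ := fun u => h (mob ζ u) with hgdef
  have hgd : ∀ u ∈ ball (0 : ℂ) R', HasDerivAt g (deriv h (mob ζ u) *
      (-(1 - (starRingEnd ℂ) ζ * ζ) / (1 - (starRingEnd ℂ) ζ * u) ^ 2)) u := by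
    intro u hu
    obtain ⟨h1, h2⟩ := hsub u hu
    exact ((hh.differentiableAt (isOpen_ball.mem_nhds h2)).hasDerivAt).comp u (mob_hasDerivAt ζ u h1)
  have hg : DifferentiableOn ℂ g (ball 0 R') := fun u hu =>
    (hgd u hu).differentiableAt.differentiableWithinAt
  have LP := aux_LP R' hR' g hg
  -- area side
  have hinv : ∀ u ∈ ball (0 : ℂ) 1, mob ζ (mob ζ u) = u := fun u hu =>
    (mob_one_sub ζ u hζ (aux_den ζ u hζ (by simpa using (mem_ball_zero_iff.1 hu).le))).2
  have himg : mob ζ '' ball (0 : ℂ) 1 = ball (0 : ℂ) 1 := by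
    have hm : ∀ u ∈ ball (0 : ℂ) 1, mob ζ u ∈ ball (0 : ℂ) 1 := fun u hu => by
      rw [mem_ball_zero_iff] at hu ⊢
      exact mob_norm_lt ζ u hζ hu
    ext u
    constructor
    · rintro ⟨v, hv, rfl⟩
      exact hm v hv
    · intro hu
      exact ⟨mob ζ u, hm u hu, hinv u hu⟩
  have hinj : Set.InjOn (mob ζ) (ball (0 : ℂ) 1) := by
    intro x hx y hy hxy
    rw [← hinv x hx, hxy, hinv y hy]
  have hcv := lintegral_image_eq_lintegral_abs_det_fderiv_mul (volume : Measure ℂ)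
    (s := ball (0 : ℂ) 1) (f := mob ζ)
    (f' := fun u => ContinuousLinearMap.restrictScalars ℝ (ContinuousLinearMap.toSpanSingleton ℂ
      (-(1 - (starRingEnd ℂ) ζ * ζ) / (1 - (starRingEnd ℂ) ζ * u) ^ 2) : ℂ →L[ℂ] ℂ))
    measurableSet_ball (fun u hu => by
      have := (mob_hasDerivAt ζ u (aux_den ζ u hζ (mem_ball_zero_iff.1 hu).le)).hasFDerivAt
      exact (this.restrictScalars ℝ).hasFDerivWithinAt) hinj
    (fun z => ENNReal.ofReal (Real.log ‖(1 - (starRingEnd ℂ) ζ * z) / (ζ - z)‖) *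
        ‖deriv h z‖ₑ ^ 2)
  rw [himg] at hcv
  rw [hcv]
  have harea : ∫⁻ u in ball (0 : ℂ) 1, ENNReal.ofReal |((ContinuousLinearMap.restrictScalars ℝ (ContinuousLinearMap.toSpanSingleton ℂ
      (-(1 - (starRingEnd ℂ) ζ * ζ) / (1 - (starRingEnd ℂ) ζ * u) ^ 2) : ℂ →L[ℂ] ℂ)) : ℂ →L[ℝ] ℂ).det| *
      (ENNReal.ofReal (Real.log ‖(1 - (starRingEnd ℂ) ζ * mob ζ u) / (ζ - mob ζ u)‖) *
        ‖deriv h (mob ζ u)‖ₑ ^ 2) =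
      ∫⁻ u in ball (0 : ℂ) 1, ENNReal.ofReal (Real.log ‖u⁻¹‖) * ‖deriv g u‖ₑ ^ 2 := by
    apply setLIntegral_congr_fun measurableSet_ball
    intro u hu
    simp only
    rw [complex_det, (hgd u (ball_subset_ball hR'.le hu)).deriv, enorm_mul, mul_pow,
      ← inv_div (ζ - mob ζ u), ← mob, hinv u hu, ENNReal.ofReal_pow (norm_nonneg _), ofReal_norm]
    ring
  rw [harea, LP]
  -- boundary side
  have hcirc : ∀ θ, circleMap 0 1 θ ∈ ball (0 : ℂ) R' := by
    intro θ; simpa using hR'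
  have hcircR : ∀ θ, circleMap 0 1 θ ∈ ball (0 : ℂ) R := by
    intro θ; simpa using hR
  have hcm := continuous_circleMap 0 1
  have hgc : Continuous fun θ : ℝ => g (circleMap 0 1 θ) :=
    hg.continuousOn.comp_continuous hcm hcirc
  have hhc : Continuous fun θ : ℝ => h (circleMap 0 1 θ) :=
    hh.continuousOn.comp_continuous hcm hcircR
  have hV : Continuous fun θ : ℝ => ‖g (circleMap 0 1 θ) - g 0‖ ^ 2 :=
    (hgc.sub continuous_const).norm.pow 2
  have hB := mob_circle ζ hζ (fun z => ‖g z - g 0‖ ^ 2) hV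
  have hg0 : g 0 = h ζ := by simp [hgdef, mob]
  have hQ : Continuous fun θ : ℝ => ‖(h (circleMap 0 1 θ) - h ζ) / (circleMap 0 1 θ - ζ)‖ ^ 2 := by
    exact (((hhc.sub continuous_const).div (hcm.sub continuous_const) (circ_sub_ne ζ hζ))).norm.pow 2
  have hBe : ∫ θ in (0 : ℝ)..(2 * π), ‖g (circleMap 0 1 θ) - g 0‖ ^ 2 = (1 - ‖ζ‖ ^ 2) *
      ∫ θ in (0 : ℝ)..(2 * π), ‖(h (circleMap 0 1 θ) - h ζ) / (circleMap 0 1 θ - ζ)‖ ^ 2 := by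
    rw [← hB, ← intervalIntegral.integral_const_mul]
    congr 1
    ext θ
    have e1 : g (mob ζ (circleMap 0 1 θ)) = h (circleMap 0 1 θ) := by
      simp only [hgdef]
      rw [(mob_one_sub ζ _ hζ (aux_den ζ _ hζ (by simp))).2]
    simp only [e1, hg0, pois, norm_div, div_pow]
    ring
  have hen : ∀ z : ℂ, ‖z‖ₑ ^ 2 = ENNReal.ofReal (‖z‖ ^ 2) := by
    intro z; rw [ENNReal.ofReal_pow (norm_nonneg _), ofReal_norm]
  have h2pi : (0:ℝ) ≤ 2 * π := by positivity
  have hl1 : ∫⁻ θ in Set.Ioc (0 : ℝ) (2 * π), ‖g (circleMap 0 1 θ) - g 0‖ₑ ^ 2 =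
      ENNReal.ofReal (∫ θ in (0 : ℝ)..(2 * π), ‖g (circleMap 0 1 θ) - g 0‖ ^ 2) := by
    simp_rw [hen]
    rw [intervalIntegral.integral_of_le h2pi, ofReal_integral_eq_lintegral_ofReal]
    · exact (hV.intervalIntegrable 0 (2 * π)).1
    · exact Eventually.of_forall fun _ => by positivity
  have hl2 : ∫⁻ θ in Set.Ioc (0 : ℝ) (2 * π),
        ‖(h (circleMap 0 1 θ) - h ζ) / (circleMap 0 1 θ - ζ)‖ₑ ^ 2 =
      ENNReal.ofReal (∫ θ in (0 : ℝ)..(2 * π),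
        ‖(h (circleMap 0 1 θ) - h ζ) / (circleMap 0 1 θ - ζ)‖ ^ 2) := by
    simp_rw [hen]
    rw [intervalIntegral.integral_of_le h2pi, ofReal_integral_eq_lintegral_ofReal]
    · exact (hQ.intervalIntegrable 0 (2 * π)).1
    · exact Eventually.of_forall fun _ => by positivity
  rw [hl1, hl2, hBe, ← ENNReal.ofReal_mul (by positivity), ← ENNReal.ofReal_mul (by positivity)]
  congr 1
  ring

lemma esq {α : Type*} [MeasurableSpace α] (μ : Measure α) (u : α → ℂ) :
    (eLpNorm u 2 μ) ^ 2 = ∫⁻ x, ‖u x‖ₑ ^ 2 ∂μ := by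
  have := eLpNorm_nnreal_pow_eq_lintegral (f := u) (μ := μ) (p := 2) two_ne_zero
  simpa using this

lemma aux_abs {α β : Type*} [MeasurableSpace α] [MeasurableSpace β] (μ : Measure α) (ν : Measure β)
    (K : ENNReal) (hK : K ≠ ⊤) (g : ℕ → α → ℂ) (g0 : α → ℂ) (q : ℕ → β → ℂ) (q0 : β → ℂ)
    (hg : ∀ n, AEStronglyMeasurable (g n) μ) (hq : ∀ n, AEStronglyMeasurable (q n) ν)
    (hgl : ∀ᵐ x ∂μ, Tendsto (fun n => g n x) atTop (nhds (g0 x)))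
    (hql : ∀ᵐ x ∂ν, Tendsto (fun n => q n x) atTop (nhds (q0 x)))
    (h1 : ∀ n, eLpNorm (g n) 2 μ = K * eLpNorm (q n) 2 ν)
    (h2 : ∀ n m, eLpNorm (g n - g m) 2 μ = K * eLpNorm (q n - q m) 2 ν)
    (hC : ∀ ε : ENNReal, 0 < ε → ∃ N, ∀ n ≥ N, ∀ m ≥ N, eLpNorm (q n - q m) 2 ν ≤ ε) :
    eLpNorm g0 2 μ = K * eLpNorm q0 2 ν := by
  have hg0 : AEStronglyMeasurable g0 μ := aestronglyMeasurable_of_tendsto_ae atTop hg hgl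
  have hq0 : AEStronglyMeasurable q0 ν := aestronglyMeasurable_of_tendsto_ae atTop hq hql
  have key : ∀ ε : ENNReal, 0 < ε → ∃ n, eLpNorm (q n - q0) 2 ν ≤ ε ∧
      eLpNorm (g n - g0) 2 μ ≤ K * ε := by
    intro ε hε
    obtain ⟨N, hN⟩ := hC ε hε
    refine ⟨N, ?_, ?_⟩
    · refine (Lp.eLpNorm_lim_le_liminf_eLpNorm (f := fun m => q N - q m)
        (fun m => (hq N).sub (hq m)) (q N - q0) ?_).trans ?_
      · filter_upwards [hql] with x hx
        exact hx.const_sub _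
      · refine liminf_le_of_frequently_le' (Eventually.frequently ?_)
        filter_upwards [eventually_ge_atTop N] with m hm
        exact hN N le_rfl m hm
    · refine (Lp.eLpNorm_lim_le_liminf_eLpNorm (f := fun m => g N - g m)
        (fun m => (hg N).sub (hg m)) (g N - g0) ?_).trans ?_
      · filter_upwards [hgl] with x hx
        exact hx.const_sub _
      · refine liminf_le_of_frequently_le' (Eventually.frequently ?_)
        filter_upwards [eventually_ge_atTop N] with m hm
        rw [h2]
        gcongr
        exact hN N le_rfl m hm
  have lim : ∀ X Y : ENNReal, (∀ ε : ENNReal, 0 < ε → X ≤ Y + 2 * K * ε) → X ≤ Y := by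
    intro X Y h
    have ht : Tendsto (fun n : ℕ => Y + 2 * K * ((n : ENNReal)⁻¹)) atTop (nhds (Y + 2 * K * 0)) := by
      refine Tendsto.add tendsto_const_nhds ?_
      exact ENNReal.Tendsto.const_mul ENNReal.tendsto_inv_nat_nhds_zero
        (Or.inr (by finiteness))
    rw [mul_zero, add_zero] at ht
    refine ge_of_tendsto ht (Eventually.of_forall fun n => h _ ?_)
    simp
  apply le_antisymm
  · apply lim
    intro ε hε
    obtain ⟨n, hn1, hn2⟩ := key ε hε
    calc eLpNorm g0 2 μ = eLpNorm (g n - (g n - g0)) 2 μ := by congr 1; ext x; simp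
      _ ≤ eLpNorm (g n) 2 μ + eLpNorm (g n - g0) 2 μ :=
          eLpNorm_sub_le (hg n) ((hg n).sub hg0) (by norm_num)
      _ = K * eLpNorm (q0 + (q n - q0)) 2 ν + eLpNorm (g n - g0) 2 μ := by
          rw [h1]; congr 3; ext x; simp
      _ ≤ K * (eLpNorm q0 2 ν + eLpNorm (q n - q0) 2 ν) + K * ε := by
          gcongr
          exact eLpNorm_add_le hq0 ((hq n).sub hq0) (by norm_num)
      _ ≤ K * (eLpNorm q0 2 ν + ε) + K * ε := by gcongr
      _ = _ := by ring
  · apply lim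
    intro ε hε
    obtain ⟨n, hn1, hn2⟩ := key ε hε
    calc K * eLpNorm q0 2 ν = K * eLpNorm (q n - (q n - q0)) 2 ν := by congr 2; ext x; simp
      _ ≤ K * (eLpNorm (q n) 2 ν + eLpNorm (q n - q0) 2 ν) := by
          gcongr
          exact eLpNorm_sub_le (hq n) ((hq n).sub hq0) (by norm_num)
      _ ≤ K * (eLpNorm (q n) 2 ν + ε) := by gcongr
      _ = eLpNorm (g0 + (g n - g0)) 2 μ + K * ε := by
          rw [mul_add, ← h1]; congr 2; ext x; simp
      _ ≤ eLpNorm g0 2 μ + eLpNorm (g n - g0) 2 μ + K * ε := by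
          gcongr
          exact eLpNorm_add_le hg0 ((hg n).sub hg0) (by norm_num)
      _ ≤ eLpNorm g0 2 μ + K * ε + K * ε := by gcongr
      _ = _ := by ring

lemma log_nonneg_disc (ζ : ℂ) (hζ : ‖ζ‖ < 1) (z : ℂ) (hz : ‖z‖ < 1) :
    0 ≤ Real.log ‖(1 - (starRingEnd ℂ) ζ * z) / (ζ - z)‖ := by
  by_cases h : ζ - z = 0
  · simp [h]
  · apply Real.log_nonneg
    rw [norm_div, one_le_div (norm_pos_iff.2 h)]
    have h1 := mob_normSq ζ z
    have : 0 ≤ (1 - ‖ζ‖ ^ 2) * (1 - ‖z‖ ^ 2) := by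
      apply mul_nonneg
      · nlinarith [norm_nonneg ζ]
      · nlinarith [norm_nonneg z]
    apply le_of_sq_le_sq _ (norm_nonneg _)
    linarith

lemma log_meas (ζ : ℂ) :
    Measurable fun z : ℂ => Real.log ‖(1 - (starRingEnd ℂ) ζ * z) / (ζ - z)‖ := by
  fun_prop

lemma aux_conv (ζ : ℂ) (hζ : ‖ζ‖ < 1) (h : ℂ → ℂ) (Q : ℝ → ℂ)
    (hQ : AEStronglyMeasurable Q (volume.restrict (Set.Ioc (0 : ℝ) (2 * π))))
    (hid : ∫⁻ z in ball (0 : ℂ) 1,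
        ENNReal.ofReal (Real.log ‖(1 - (starRingEnd ℂ) ζ * z) / (ζ - z)‖) * ‖deriv h z‖ₑ ^ 2
      = ENNReal.ofReal ((1 - ‖ζ‖ ^ 2) / 4) * ∫⁻ θ in Set.Ioc (0 : ℝ) (2 * π), ‖Q θ‖ₑ ^ 2) :
    (2 / (1 - ‖ζ‖ ^ 2)) * (π⁻¹ * ∫ z in ball (0 : ℂ) 1,
        Real.log ‖(1 - (starRingEnd ℂ) ζ * z) / (ζ - z)‖ * ‖deriv h z‖ ^ 2)
      = (1 / (2 * π)) * ∫ θ in (0 : ℝ)..(2 * π), ‖Q θ‖ ^ 2 := by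
  have hz1 : 0 < 1 - ‖ζ‖ ^ 2 := by nlinarith [norm_nonneg ζ]
  have hen : ∀ z : ℂ, ‖z‖ₑ ^ 2 = ENNReal.ofReal (‖z‖ ^ 2) := by
    intro z; rw [ENNReal.ofReal_pow (norm_nonneg _), ofReal_norm]
  have e1 : ∫ z in ball (0 : ℂ) 1,
        Real.log ‖(1 - (starRingEnd ℂ) ζ * z) / (ζ - z)‖ * ‖deriv h z‖ ^ 2
      = (∫⁻ z in ball (0 : ℂ) 1,
        ENNReal.ofReal (Real.log ‖(1 - (starRingEnd ℂ) ζ * z) / (ζ - z)‖) * ‖deriv h z‖ₑ ^ 2).toReal := by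
    rw [integral_eq_lintegral_of_nonneg_ae]
    · congr 1
      apply setLIntegral_congr_fun measurableSet_ball
      intro z hz
      simp only
      rw [ENNReal.ofReal_mul (log_nonneg_disc ζ hζ z (mem_ball_zero_iff.1 hz)), hen]
    · refine (ae_restrict_iff' measurableSet_ball).2 (Eventually.of_forall fun z hz => ?_)
      exact mul_nonneg (log_nonneg_disc ζ hζ z (mem_ball_zero_iff.1 hz)) (by positivity)
    · apply Measurable.aestronglyMeasurable
      exact (log_meas ζ).mul ((measurable_deriv h).norm.pow_const 2)
  have e2 : ∫ θ in (0 : ℝ)..(2 * π), ‖Q θ‖ ^ 2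
      = (∫⁻ θ in Set.Ioc (0 : ℝ) (2 * π), ‖Q θ‖ₑ ^ 2).toReal := by
    rw [intervalIntegral.integral_of_le (by positivity), integral_eq_lintegral_of_nonneg_ae]
    · simp_rw [hen]
    · exact Eventually.of_forall fun _ => by positivity
    · exact hQ.norm.pow 2
  rw [e1, e2, hid, ENNReal.toReal_mul, ENNReal.toReal_ofReal (by positivity)]
  field_simp
  ring

lemma part_two (ζ : ℂ) (hζ : ‖ζ‖ < 1) (w : ℂ) (hw : ‖w‖ < 1) :
    (2 / (1 - ‖ζ‖ ^ 2)) * (π⁻¹ * ∫ z in ball (0 : ℂ) 1,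
          Real.log ‖(1 - (starRingEnd ℂ) ζ * z) / (ζ - z)‖ *
            ‖deriv (fun u : ℂ => (1 - (starRingEnd ℂ) w * u)⁻¹) z‖ ^ 2)
        = ‖(starRingEnd ℂ) w / (1 - (starRingEnd ℂ) w * ζ)‖ ^ 2 * (1 - ‖w‖ ^ 2)⁻¹ := by
  set R : ℝ := 2 / (1 + ‖w‖) with hRdef
  have hw0 := norm_nonneg w
  have hR : 1 < R := by
    rw [hRdef, lt_div_iff₀ (by positivity)]; linarith
  have hRw : ‖w‖ * R < 1 := by
    rw [hRdef, mul_div_assoc', div_lt_one (by positivity)]; linarith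
  have hden : ∀ u ∈ ball (0 : ℂ) R, 1 - (starRingEnd ℂ) w * u ≠ 0 := by
    intro u hu h
    have h1 : (starRingEnd ℂ) w * u = 1 := by linear_combination -h
    have h2 : ‖w‖ * ‖u‖ = 1 := by
      have := congrArg norm h1
      simpa using this
    have := (mem_ball_zero_iff.1 hu).le
    nlinarith
  have hd : DifferentiableOn ℂ (fun u : ℂ => (1 - (starRingEnd ℂ) w * u)⁻¹) (ball 0 R) := by
    apply DifferentiableOn.inv _ hden
    fun_prop
  have hb := aux_base ζ hζ R hR _ hd
  have hdζ := aux_den w ζ hw hζ.le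
  have hQ : ∀ θ : ℝ, ((1 - (starRingEnd ℂ) w * circleMap 0 1 θ)⁻¹ - (1 - (starRingEnd ℂ) w * ζ)⁻¹) /
      (circleMap 0 1 θ - ζ) = (starRingEnd ℂ) w / (1 - (starRingEnd ℂ) w * ζ) *
        (1 - (starRingEnd ℂ) w * circleMap 0 1 θ)⁻¹ := by
    intro θ
    have h1 := aux_den w (circleMap 0 1 θ) hw (by simp)
    have h2 := circ_sub_ne ζ hζ θ
    have h3 := mul_inv_cancel₀ h1
    have h4 := mul_inv_cancel₀ hdζ
    rw [div_eq_iff h2, div_eq_mul_inv]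
    linear_combination (-(1 - (starRingEnd ℂ) w * circleMap 0 1 θ)⁻¹) * h4 +
      (1 - (starRingEnd ℂ) w * ζ)⁻¹ * h3
  simp_rw [hQ] at hb
  rw [aux_conv ζ hζ _ _ _ hb]
  · simp_rw [norm_mul, mul_pow]
    rw [intervalIntegral.integral_const_mul, aux_kernel w hw]
    field_simp
  · apply Continuous.aestronglyMeasurable
    have := continuous_circleMap 0 1
    apply Continuous.mul continuous_const
    apply Continuous.inv₀ (by fun_prop)
    intro θ
    exact aux_den w (circleMap 0 1 θ) hw (by simp)

lemma aux_base_norm (ζ : ℂ) (hζ : ‖ζ‖ < 1) (R : ℝ) (hR : 1 < R) (h : ℂ → ℂ)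
    (hh : DifferentiableOn ℂ h (ball 0 R)) :
    eLpNorm (deriv h) 2 ((volume.restrict (ball (0 : ℂ) 1)).withDensity
        fun z => ENNReal.ofReal (Real.log ‖(1 - (starRingEnd ℂ) ζ * z) / (ζ - z)‖))
      = ENNReal.ofReal (Real.sqrt ((1 - ‖ζ‖ ^ 2) / 4)) *
        eLpNorm (fun θ : ℝ => (h (circleMap 0 1 θ) - h ζ) / (circleMap 0 1 θ - ζ)) 2
          (volume.restrict (Set.Ioc (0 : ℝ) (2 * π))) := by
  have hz1 : 0 < 1 - ‖ζ‖ ^ 2 := by nlinarith [norm_nonneg ζ]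
  apply (ENNReal.pow_right_strictMono two_ne_zero).injective
  simp only
  rw [mul_pow, esq, esq, ← ENNReal.ofReal_pow (by positivity), Real.sq_sqrt (by positivity),
    lintegral_withDensity_eq_lintegral_mul _ (log_meas ζ).ennreal_ofReal
      ((measurable_deriv h).enorm.pow_const 2)]
  exact aux_base ζ hζ R hR h hh

lemma aux_cauchy (f : ℂ → ℂ) (hf : DifferentiableOn ℂ f (ball (0 : ℂ) 1))
    (hH2 : Summable fun n : ℕ => ‖iteratedDeriv n f 0 / (n.factorial : ℂ)‖ ^ 2)
    (r : ℕ → ℝ) (hr0 : ∀ n, 0 < r n) (hr1 : ∀ n, r n < 1) (hr : Tendsto r atTop (nhds 1)) :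
    Tendsto (fun p : ℕ × ℕ => eLpNorm (fun θ : ℝ => f (r p.1 * circleMap 0 1 θ) -
      f (r p.2 * circleMap 0 1 θ)) 2 (volume.restrict (Set.Ioc (0 : ℝ) (2 * π)))) atTop (nhds 0) := by
  set a : ℕ → ℂ := fun n => iteratedDeriv n f 0 / (n.factorial : ℂ) with ha
  replace hH2 : Summable fun n => ‖a n‖ ^ 2 := hH2
  have hsum : ∀ z : ℂ, ‖z‖ < 1 → HasSum (fun n : ℕ => a n * z ^ n) (f z) := by
    intro z hz
    have := Complex.hasSum_taylorSeries_on_ball hf (z := z) (by simpa using hz)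
    have e : (fun n : ℕ => a n * z ^ n) =
        fun n : ℕ => ((n.factorial : ℂ))⁻¹ • (z - 0) ^ n • iteratedDeriv n f 0 := by
      funext n
      simp only [smul_eq_mul, sub_zero, ha]
      ring
    rw [e]
    exact this
  have hsn : ∀ n, Summable fun k => ‖a k * (r n : ℂ) ^ k‖ := fun n =>
    (hsum (r n) (by simpa [abs_of_pos (hr0 n)] using hr1 n)).summable.norm
  set S : ℕ × ℕ → ℝ := fun p => ∑' k, ‖a k‖ ^ 2 * (r p.1 ^ k - r p.2 ^ k) ^ 2 with hS
  have hp1 : ∀ n k, 0 ≤ r n ^ k ∧ r n ^ k ≤ 1 := fun n k =>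
    ⟨pow_nonneg (hr0 n).le k, pow_le_one₀ (hr0 n).le (hr1 n).le⟩
  have hbd : ∀ p : ℕ × ℕ, ∀ k, ‖‖a k‖ ^ 2 * (r p.1 ^ k - r p.2 ^ k) ^ 2‖ ≤ ‖a k‖ ^ 2 := by
    intro p k
    rw [Real.norm_of_nonneg (by positivity)]
    apply mul_le_of_le_one_right (by positivity)
    have h1 := hp1 p.1 k
    have h2 := hp1 p.2 k
    rw [sq_le_one_iff_abs_le_one, abs_le]
    constructor <;> linarith [h1.1, h1.2, h2.1, h2.2]
  have hr1' : Tendsto (fun p : ℕ × ℕ => r p.1) atTop (nhds 1) := by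
    rw [← prod_atTop_atTop_eq]; exact hr.comp tendsto_fst
  have hr2' : Tendsto (fun p : ℕ × ℕ => r p.2) atTop (nhds 1) := by
    rw [← prod_atTop_atTop_eq]; exact hr.comp tendsto_snd
  have hSlim : Tendsto S atTop (nhds 0) := by
    have := tendsto_tsum_of_dominated_convergence (𝓕 := (atTop : Filter (ℕ × ℕ)))
      (f := fun p k => ‖a k‖ ^ 2 * (r p.1 ^ k - r p.2 ^ k) ^ 2) (g := fun _ => (0 : ℝ)) hH2
      (fun k => by
        have := (((hr1'.pow k).sub (hr2'.pow k)).pow 2).const_mul (‖a k‖ ^ 2)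
        simpa using this) (Eventually.of_forall hbd)
    simpa using this
  have heq : ∀ p : ℕ × ℕ, eLpNorm (fun θ : ℝ => f (r p.1 * circleMap 0 1 θ) -
      f (r p.2 * circleMap 0 1 θ)) 2 (volume.restrict (Set.Ioc (0 : ℝ) (2 * π)))
      = ENNReal.ofReal (Real.sqrt (2 * π * S p)) := by
    intro p
    have hSp : 0 ≤ S p := tsum_nonneg fun k => by positivity
    apply (ENNReal.pow_right_strictMono two_ne_zero).injective
    simp only
    rw [esq, ← ENNReal.ofReal_pow (by positivity), Real.sq_sqrt (by positivity)]
    have hcs : Summable fun k => ‖a k * ((r p.1 : ℂ) ^ k - (r p.2 : ℂ) ^ k)‖ := by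
      refine Summable.of_nonneg_of_le (fun _ => norm_nonneg _) (fun k => ?_)
        ((hsn p.1).add (hsn p.2))
      rw [mul_sub]
      exact norm_sub_le _ _
    have e1 : ∀ θ : ℝ, f (r p.1 * circleMap 0 1 θ) - f (r p.2 * circleMap 0 1 θ) =
        ∑' k, a k * ((r p.1 : ℂ) ^ k - (r p.2 : ℂ) ^ k) * circleMap 0 1 θ ^ k := by
      intro θ
      have h1 := hsum (r p.1 * circleMap 0 1 θ) (by simpa [abs_of_pos (hr0 p.1)] using hr1 p.1)
      have h2 := hsum (r p.2 * circleMap 0 1 θ) (by simpa [abs_of_pos (hr0 p.2)] using hr1 p.2)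
      rw [← (h1.sub h2).tsum_eq]
      congr 1
      ext k
      ring
    simp_rw [e1]
    have hpv := aux_lparseval 0 _ hcs
    rw [zero_add] at hpv
    rw [hpv, ENNReal.ofReal_mul (p := 2 * π) (by positivity)]
    congr 1
    simp only [hS]
    rw [ENNReal.ofReal_tsum_of_nonneg (fun _ => by positivity)
      (Summable.of_norm_bounded hH2 (hbd p))]
    congr 1
    ext k
    rw [← ofReal_norm, ← ENNReal.ofReal_pow (norm_nonneg _), norm_mul, mul_pow]
    congr 2
    rw [← Complex.ofReal_pow, ← Complex.ofReal_pow, ← Complex.ofReal_sub, Complex.norm_real,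
      Real.norm_eq_abs, sq_abs]
  simp_rw [heq]
  have h1 : Tendsto (fun p => Real.sqrt (2 * π * S p)) atTop (nhds (Real.sqrt (2 * π * 0))) :=
    (Real.continuous_sqrt.tendsto _).comp (hSlim.const_mul _)
  have h2 := ENNReal.tendsto_ofReal h1
  simpa using h2

lemma part_one (ζ : ℂ) (hζ : ‖ζ‖ < 1) (f F : ℂ → ℂ)
    (hf : DifferentiableOn ℂ f (ball (0 : ℂ) 1))
    (hH2 : Summable fun n : ℕ => ‖iteratedDeriv n f 0 / (n.factorial : ℂ)‖ ^ 2)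
    (hFlim : ∀ᵐ θ ∂(volume.restrict (Set.Ioc (0 : ℝ) (2 * π))),
      Tendsto (fun r : ℝ => f ((r : ℂ) * circleMap 0 1 θ)) (nhdsWithin 1 (Set.Iio 1))
        (nhds (F (circleMap 0 1 θ)))) :
    (2 / (1 - ‖ζ‖ ^ 2)) * (π⁻¹ * ∫ z in ball (0 : ℂ) 1,
        Real.log ‖(1 - (starRingEnd ℂ) ζ * z) / (ζ - z)‖ * ‖deriv f z‖ ^ 2)
      = (1 / (2 * π)) * ∫ θ in (0 : ℝ)..(2 * π),
          ‖(F (circleMap 0 1 θ) - f ζ) / (circleMap 0 1 θ - ζ)‖ ^ 2 := by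
  have hz1 : 0 < 1 - ‖ζ‖ ^ 2 := by nlinarith [norm_nonneg ζ]
  set r : ℕ → ℝ := fun n => 1 - 1 / ((n : ℝ) + 2) with hrdef
  have hr0 : ∀ n, 0 < r n := by
    intro n
    have : 1 / ((n : ℝ) + 2) < 1 := by
      rw [div_lt_one (by positivity)]; linarith [(Nat.cast_nonneg n : (0 : ℝ) ≤ n)]
    simp only [hrdef]; linarith
  have hr1 : ∀ n, r n < 1 := by
    intro n
    have : 0 < 1 / ((n : ℝ) + 2) := by positivity
    simp only [hrdef]; linarith
  have hr : Tendsto r atTop (nhds 1) := by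
    have h1 : Tendsto (fun n : ℕ => 1 / ((n : ℝ) + 2)) atTop (nhds 0) := by
      simp only [one_div]
      exact tendsto_inv_atTop_zero.comp
        (tendsto_atTop_add_const_right _ _ tendsto_natCast_atTop_atTop)
    have h2 := h1.const_sub 1
    rw [sub_zero] at h2
    exact h2
  have hrw : Tendsto r atTop (nhdsWithin 1 (Set.Iio 1)) :=
    tendsto_nhdsWithin_iff.2 ⟨hr, Eventually.of_forall hr1⟩
  have hrn : ∀ n, ‖(r n : ℂ)‖ = r n := fun n => by simp [abs_of_pos (hr0 n)]
  -- dilations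
  set fd : ℕ → ℂ → ℂ := fun n z => f (r n * z) with hfd
  have hmem : ∀ n z, z ∈ ball (0 : ℂ) (1 / r n) → (r n : ℂ) * z ∈ ball (0 : ℂ) 1 := by
    intro n z hz
    rw [mem_ball_zero_iff] at hz ⊢
    rw [norm_mul, hrn, mul_comm]
    exact (lt_div_iff₀ (hr0 n)).1 hz
  have hRn : ∀ n, 1 < 1 / r n := fun n => by
    rw [lt_div_iff₀ (hr0 n)]; linarith [hr1 n]
  have hfdd : ∀ n z, z ∈ ball (0 : ℂ) (1 / r n) →
      HasDerivAt (fd n) (deriv f (r n * z) * r n) z := by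
    intro n z hz
    have h1 := (hf.differentiableAt (isOpen_ball.mem_nhds (hmem n z hz))).hasDerivAt
    have h2 : HasDerivAt (fun z : ℂ => (r n : ℂ) * z) (r n) z := by
      simpa using (hasDerivAt_id z).const_mul (r n : ℂ)
    exact h1.comp z h2
  have hfdo : ∀ n, DifferentiableOn ℂ (fd n) (ball 0 (1 / r n)) := fun n z hz =>
    (hfdd n z hz).differentiableAt.differentiableWithinAt
  have hsub1 : ∀ n, ball (0 : ℂ) 1 ⊆ ball 0 (1 / r n) := fun n => ball_subset_ball (hRn n).le
  set μ : Measure ℂ := (volume.restrict (ball (0 : ℂ) 1)).withDensity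
        fun z => ENNReal.ofReal (Real.log ‖(1 - (starRingEnd ℂ) ζ * z) / (ζ - z)‖) with hμ
  set ν : Measure ℝ := volume.restrict (Set.Ioc (0 : ℝ) (2 * π)) with hν
  have hae : ∀ᵐ z ∂μ, z ∈ ball (0 : ℂ) 1 :=
    (withDensity_absolutelyContinuous _ _).ae_le (ae_restrict_mem measurableSet_ball)
  set q : ℕ → ℝ → ℂ := fun n θ => (fd n (circleMap 0 1 θ) - fd n ζ) / (circleMap 0 1 θ - ζ) with hq
  have hcm := continuous_circleMap 0 1
  have hfdc : ∀ n, Continuous fun θ : ℝ => fd n (circleMap 0 1 θ) := fun n =>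
    (hfdo n).continuousOn.comp_continuous hcm (fun θ => by simpa using hRn n)
  have hqm : ∀ n, AEStronglyMeasurable (q n) ν := fun n =>
    (((hfdc n).sub continuous_const).div (hcm.sub continuous_const)
      (circ_sub_ne ζ hζ)).aestronglyMeasurable
  have hζb : ζ ∈ ball (0 : ℂ) 1 := mem_ball_zero_iff.2 hζ
  have hmulr : ∀ z : ℂ, Tendsto (fun n => (r n : ℂ) * z) atTop (nhds z) := by
    intro z
    have h1 : Tendsto (fun n => (r n : ℂ)) atTop (nhds ((1 : ℝ) : ℂ)) :=
      (Complex.continuous_ofReal.tendsto 1).comp hr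
    simpa using h1.mul_const z
  have hfζ : Tendsto (fun n => fd n ζ) atTop (nhds (f ζ)) :=
    ((hf.differentiableAt (isOpen_ball.mem_nhds hζb)).continuousAt.tendsto).comp (hmulr ζ)
  have hql : ∀ᵐ θ ∂ν, Tendsto (fun n => q n θ) atTop
      (nhds ((F (circleMap 0 1 θ) - f ζ) / (circleMap 0 1 θ - ζ))) := by
    filter_upwards [hFlim] with θ hθ
    exact ((hθ.comp hrw).sub hfζ).div_const _
  have hgl : ∀ᵐ z ∂μ, Tendsto (fun n => deriv (fd n) z) atTop (nhds (deriv f z)) := by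
    filter_upwards [hae] with z hz
    have h1 : ∀ n, deriv (fd n) z = deriv f (r n * z) * r n := fun n =>
      (hfdd n z (hsub1 n hz)).deriv
    simp_rw [h1]
    have h2 : Tendsto (fun n => deriv f (r n * z)) atTop (nhds (deriv f z)) :=
      ((((hf.deriv isOpen_ball).differentiableAt
        (isOpen_ball.mem_nhds hz)).continuousAt.tendsto).comp (hmulr z))
    have h3 : Tendsto (fun n => (r n : ℂ)) atTop (nhds 1) := by simpa using hmulr 1
    simpa using h2.mul h3
  have key := aux_abs μ ν (ENNReal.ofReal (Real.sqrt ((1 - ‖ζ‖ ^ 2) / 4))) ENNReal.ofReal_ne_top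
    (fun n => deriv (fd n)) (deriv f) q (fun θ => (F (circleMap 0 1 θ) - f ζ) / (circleMap 0 1 θ - ζ))
    (fun n => (measurable_deriv _).aestronglyMeasurable) hqm hgl hql
    (fun n => aux_base_norm ζ hζ (1 / r n) (hRn n) (fd n) (hfdo n))
    (fun n m => by
      have hmin : 1 < min (1 / r n) (1 / r m) := lt_min (hRn n) (hRn m)
      have hb := aux_base_norm ζ hζ _ hmin (fun z => fd n z - fd m z)
        (((hfdo n).mono (ball_subset_ball (min_le_left _ _))).sub
          ((hfdo m).mono (ball_subset_ball (min_le_right _ _))))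
      have e1 : eLpNorm (deriv (fd n) - deriv (fd m)) 2 μ
          = eLpNorm (deriv fun z => fd n z - fd m z) 2 μ := by
        apply eLpNorm_congr_ae
        filter_upwards [hae] with z hz
        have h1 := hfdd n z (hsub1 n hz)
        have h2 := hfdd m z (hsub1 m hz)
        rw [Pi.sub_apply, h1.deriv, h2.deriv]
        exact (h1.sub h2).deriv.symm
      rw [e1, hb]
      congr 2
      ext θ
      simp only [hq, Pi.sub_apply]
      ring)
    (by
      intro ε hε
      have hz2 : 0 < 1 - ‖ζ‖ := by linarith
      set C : ℝ := (1 - ‖ζ‖)⁻¹ with hC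
      have hT1 := aux_cauchy f hf hH2 r hr0 hr1 hr
      have hT2 : Tendsto (fun p : ℕ × ℕ => fd p.1 ζ - fd p.2 ζ) atTop (nhds 0) := by
        rw [← prod_atTop_atTop_eq]
        simpa using (hfζ.comp tendsto_fst).sub (hfζ.comp tendsto_snd)
      have hT3 : Tendsto (fun p : ℕ × ℕ => eLpNorm (fun _ : ℝ => fd p.1 ζ - fd p.2 ζ) 2 ν)
          atTop (nhds 0) := by
        have e : ∀ p : ℕ × ℕ, eLpNorm (fun _ : ℝ => fd p.1 ζ - fd p.2 ζ) 2 ν =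
            ‖fd p.1 ζ - fd p.2 ζ‖ₑ * eLpNorm (fun _ : ℝ => (1 : ℂ)) 2 ν := by
          intro p
          have := eLpNorm_const_smul (fd p.1 ζ - fd p.2 ζ) (fun _ : ℝ => (1 : ℂ)) 2 ν
          rw [← this]
          congr 1
          ext θ
          simp
        simp_rw [e]
        have hfin : eLpNorm (fun _ : ℝ => (1 : ℂ)) 2 ν ≠ ⊤ := (memLp_const (1 : ℂ)).2.ne
        have := ENNReal.Tendsto.mul_const (hT2.enorm) (Or.inr hfin)
        simpa using this
      have hT := ENNReal.Tendsto.const_mul (a := ENNReal.ofReal C) (hT1.add hT3)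
        (Or.inr ENNReal.ofReal_ne_top)
      rw [add_zero, mul_zero] at hT
      have hev := (hT.eventually (ge_mem_nhds hε))
      rw [eventually_atTop] at hev
      obtain ⟨⟨N1, N2⟩, hN⟩ := hev
      refine ⟨max N1 N2, fun n hn m hm => ?_⟩
      refine le_trans ?_ (hN (n, m) ⟨(le_max_left _ _).trans hn, (le_max_right _ _).trans hm⟩)
      refine (eLpNorm_le_mul_eLpNorm_of_ae_le_mul (c := C)
        (g := fun θ : ℝ => (fd n (circleMap 0 1 θ) - fd m (circleMap 0 1 θ)) - (fd n ζ - fd m ζ))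
        (Eventually.of_forall fun θ => ?_) 2).trans ?_
      · have e : (q n - q m) θ = ((fd n (circleMap 0 1 θ) - fd m (circleMap 0 1 θ)) -
            (fd n ζ - fd m ζ)) / (circleMap 0 1 θ - ζ) := by
          simp only [hq, Pi.sub_apply]; ring
        rw [e, norm_div, div_eq_inv_mul]
        gcongr
        rw [hC]
        apply inv_anti₀ hz2
        have := norm_sub_norm_le (circleMap 0 1 θ) ζ
        simpa using this
      · gcongr
        exact eLpNorm_sub_le ((hfdc n).sub (hfdc m)).aestronglyMeasurable
          aestronglyMeasurable_const (by norm_num))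
  refine aux_conv ζ hζ f _ (aestronglyMeasurable_of_tendsto_ae atTop hqm hql) ?_
  have key2 := congrArg (fun x => x ^ 2) key
  beta_reduce at key2
  rw [mul_pow, esq, esq, ← ENNReal.ofReal_pow (by positivity), Real.sq_sqrt (by positivity), hμ,
    lintegral_withDensity_eq_lintegral_mul _ (log_meas ζ).ennreal_ofReal
      ((measurable_deriv f).enorm.pow_const 2)] at key2
  exact key2

/-- Douglas-type formula for `ζ ∈ 𝔻` and `f ∈ H²` (square-summable Taylor coefficients,
with a.e. radial boundary values `F`):
`D_ζ(f) = (2/(1−|ζ|²)) ∫_𝔻 log|(1−conj ζ·z)/(ζ−z)| |f′|² dA = (1/2π) ∫_𝕋 |(F(λ)−f(ζ))/(λ−ζ)|² |dλ|`,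
with `dA` normalized area measure. In particular, for the Cauchy kernel `k_w`,
`D_ζ(k_w) = ‖(conj w/(1−conj w·ζ)) k_w‖²_{H²} = |conj w/(1−conj w·ζ)|²/(1−|w|²)`. -/
theorem stmt_11 (ζ : ℂ) (hζ : ζ ∈ ball (0 : ℂ) 1) (f F : ℂ → ℂ)
    (hf : DifferentiableOn ℂ f (ball (0 : ℂ) 1))
    (hH2 : Summable fun n : ℕ => ‖iteratedDeriv n f 0 / (n.factorial : ℂ)‖ ^ 2)
    (hFlim : ∀ᵐ θ ∂(volume.restrict (Set.Ioc (0 : ℝ) (2 * π))),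
      Tendsto (fun r : ℝ => f ((r : ℂ) * circleMap 0 1 θ)) (nhdsWithin 1 (Set.Iio 1))
        (nhds (F (circleMap 0 1 θ)))) :
    ((2 / (1 - ‖ζ‖ ^ 2)) * (π⁻¹ * ∫ z in ball (0 : ℂ) 1,
        Real.log ‖(1 - (starRingEnd ℂ) ζ * z) / (ζ - z)‖ * ‖deriv f z‖ ^ 2)
      = (1 / (2 * π)) * ∫ θ in (0 : ℝ)..(2 * π),
          ‖(F (circleMap 0 1 θ) - f ζ) / (circleMap 0 1 θ - ζ)‖ ^ 2) ∧
    ∀ w ∈ ball (0 : ℂ) 1,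
      (2 / (1 - ‖ζ‖ ^ 2)) * (π⁻¹ * ∫ z in ball (0 : ℂ) 1,
          Real.log ‖(1 - (starRingEnd ℂ) ζ * z) / (ζ - z)‖ *
            ‖deriv (fun u : ℂ => (1 - (starRingEnd ℂ) w * u)⁻¹) z‖ ^ 2)
        = ‖(starRingEnd ℂ) w / (1 - (starRingEnd ℂ) w * ζ)‖ ^ 2 * (1 - ‖w‖ ^ 2)⁻¹ := by
  exact ⟨part_one ζ (mem_ball_zero_iff.1 hζ) f F hf hH2 hFlim, fun w hw =>
    part_two ζ (mem_ball_zero_iff.1 hζ) w (mem_ball_zero_iff.1 hw)⟩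
end

section
/- For ζ on the unit circle, the weight ω_ζ(z) = (1 − |z|²)/|ζ − z|² (the Poisson kernel at ζ) satisfies (1 − |z|²)|Qω_ζ(z)|² = Bω_ζ(z) for all z ∈ 𝔻, where Q is the Bergman projection and B is the Berezin transform. -/
open Complex Metric MeasureTheory Real

lemma polar_int (f : ℂ → ℂ) (hf : Integrable f) :
    IntegrableOn (fun p : ℝ × ℝ => p.1 • f (Complex.polarCoord.symm p)) polarCoord.target := by
  have h1 : Integrable (fun p : ℝ × ℝ => f (measurableEquivRealProd.symm p)) :=
    (Complex.volume_preserving_equiv_real_prod.symm.integrable_comp_emb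
      measurableEquivRealProd.symm.measurableEmbedding).2 hf
  have h2 := (integrableOn_image_iff_integrableOn_abs_det_fderiv_smul volume
    (polarCoord.open_target.measurableSet)
    (fun p _ ↦ (hasFDerivAt_polarCoord_symm p).hasFDerivWithinAt) polarCoord.symm.injOn
    (fun p : ℝ × ℝ => f (measurableEquivRealProd.symm p))).1 h1.integrableOn
  refine h2.congr_fun (fun p hp => ?_) polarCoord.open_target.measurableSet
  have : 0 < p.1 := hp.1
  simp only [det_fderivPolarCoordSymm, abs_of_pos this]
  rw [measurableEquivRealProd_symm_polarCoord_symm_apply]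

lemma disc_polar (f : ℂ → ℂ) (hf : IntegrableOn f (ball 0 1)) :
    ∫ w in ball (0 : ℂ) 1, f w =
      ∫ r in (0:ℝ)..1, r • ∫ θ in (0:ℝ)..2 * π, f (circleMap 0 r θ) := by
  rw [← integral_indicator measurableSet_ball, ← Complex.integral_comp_polarCoord_symm]
  have h := polar_int _ ((integrable_indicator_iff measurableSet_ball).2 hf)
  have ht : polarCoord.target = Set.Ioi (0 : ℝ) ×ˢ Set.Ioo (-π) π := rfl
  rw [ht] at h ⊢
  rw [Measure.volume_eq_prod] at h ⊢
  rw [setIntegral_prod _ h, intervalIntegral.integral_of_le zero_le_one,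
    integral_Ioc_eq_integral_Ioo, ← Set.Ioi_inter_Iio (a := (0:ℝ)) (b := 1),
    ← setIntegral_indicator measurableSet_Iio]
  refine setIntegral_congr_fun measurableSet_Ioi (fun r hr => ?_)
  have hr : 0 < r := hr
  have hc : ∀ θ : ℝ, Complex.polarCoord.symm (r, θ) = circleMap 0 r θ := by
    intro θ
    simp [circleMap, Complex.exp_mul_I]
  simp only [hc]
  by_cases h1 : r < 1
  · rw [Set.indicator_of_mem (show r ∈ Set.Iio 1 from h1)]
    have hm : ∀ θ : ℝ, circleMap 0 r θ ∈ ball (0:ℂ) 1 := by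
      intro θ; simp [abs_of_pos hr, h1]
    simp only [Set.indicator_of_mem (hm _)]
    rw [integral_smul]
    congr 1
    rw [← integral_Ioc_eq_integral_Ioo, ← intervalIntegral.integral_of_le (by linarith [pi_pos])]
    have hp : Function.Periodic (fun θ => f (circleMap 0 r θ)) (2 * π) := fun θ => by
      simp only [periodic_circleMap 0 r θ]
    have := hp.intervalIntegral_add_eq (-π) 0
    rw [show -π + 2 * π = π by ring, zero_add] at this
    exact this
  · rw [Set.indicator_of_notMem (show r ∉ Set.Iio 1 from h1)]
    have hm : ∀ θ : ℝ, circleMap 0 r θ ∉ ball (0:ℂ) 1 := by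
      intro θ; simp [abs_of_pos hr]; linarith
    simp only [Set.indicator_of_notMem (hm _)]
    simp

lemma one_sub_ne {w z : ℂ} (hw : ‖w‖ ≤ 1) (hz : ‖z‖ < 1) :
    1 - (starRingEnd ℂ) w * z ≠ 0 := by
  intro h
  have h1 : (starRingEnd ℂ) w * z = 1 := (sub_eq_zero.1 h).symm
  have h2 := congrArg norm h1
  rw [norm_mul, RCLike.norm_conj, norm_one] at h2
  nlinarith [norm_nonneg w, norm_nonneg z]

lemma angular (g : ℂ → ℂ) (hg : DifferentiableOn ℂ g (ball 0 1)) (z : ℂ) (hz : ‖z‖ < 1)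
    (r : ℝ) (h0 : 0 < r) (h1 : r < 1) :
    ∫ θ in (0:ℝ)..2 * π, g (circleMap 0 r θ) / (1 - (starRingEnd ℂ) (circleMap 0 r θ) * z) ^ 2
      = 2 * π * deriv (fun w => w * g w) ((r:ℂ) ^ 2 * z) := by
  have hin : ((r:ℂ) ^ 2 * z) ∈ ball (0:ℂ) r := by
    simp [abs_of_pos h0]; nlinarith [norm_nonneg z]
  have hG : DifferentiableOn ℂ (fun w => w * g w) (ball 0 1) := differentiableOn_id.mul hg
  have := two_pi_I_inv_smul_circleIntegral_sub_sq_inv_smul_of_differentiable (isOpen_ball)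
    (closedBall_subset_ball h1) hG hin
  rw [← this, circleIntegral, smul_eq_mul, ← intervalIntegral.integral_const_mul,
    ← intervalIntegral.integral_const_mul]
  refine intervalIntegral.integral_congr (fun θ _ => ?_)
  simp only [deriv_circleMap, smul_eq_mul]
  set w := circleMap 0 r θ with hw
  have hwn : ‖w‖ = r := by simp [hw, abs_of_pos h0]
  have hw0 : w ≠ 0 := by rw [← norm_pos_iff, hwn]; exact h0
  have hww : (r:ℂ) ^ 2 = w * (starRingEnd ℂ) w := by
    rw [Complex.mul_conj, Complex.normSq_eq_norm_sq, hwn]; push_cast; rfl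
  have hne : 1 - (starRingEnd ℂ) w * z ≠ 0 := one_sub_ne (by rw [hwn]; exact h1.le) hz
  have hpi : (π : ℂ) ≠ 0 := by exact_mod_cast pi_ne_zero
  rw [hww, show w - w * (starRingEnd ℂ) w * z = w * (1 - (starRingEnd ℂ) w * z) by ring]
  have hI := I_ne_zero
  field_simp

lemma reproduce (g : ℂ → ℂ) (hg : DifferentiableOn ℂ g (ball 0 1))
    (z : ℂ) (hz : ‖z‖ < 1)
    (hi : IntegrableOn (fun w => g w / (1 - (starRingEnd ℂ) w * z) ^ 2) (ball 0 1)) :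
    ∫ w in ball (0 : ℂ) 1, g w / (1 - (starRingEnd ℂ) w * z) ^ 2 = π * g z := by
  rw [disc_polar _ hi]
  have e : ∀ r ∈ Set.Icc (0:ℝ) 1, ((r:ℂ) ^ 2 * z) ∈ ball (0:ℂ) 1 := by
    intro r hr
    have : r ^ 2 ≤ 1 := by nlinarith [hr.1, hr.2]
    simp
    nlinarith [norm_nonneg z, sq_nonneg r]
  have hG : DifferentiableOn ℂ (fun w => w * g w) (ball 0 1) := differentiableOn_id.mul hg
  have hd := hG.deriv isOpen_ball
  by_cases hz0 : z = 0
  · subst hz0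
    have : ∀ r ∈ Set.Ioo (0:ℝ) 1, (r • ∫ θ in (0:ℝ)..2 * π,
      g (circleMap 0 r θ) / (1 - (starRingEnd ℂ) (circleMap 0 r θ) * 0) ^ 2)
      = (2 * π * g 0) * r := by
      intro r hr
      rw [angular g hg 0 (by simp) r hr.1 hr.2, mul_zero]
      have hD := ((hasDerivAt_id (0:ℂ)).mul
        ((hg.differentiableAt (ball_mem_nhds _ one_pos)).hasDerivAt)).deriv
      have hD' : deriv (fun w => w * g w) 0 = g 0 := by
        refine Eq.trans hD ?_
        simp
      rw [hD', real_smul]; ring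
    rw [intervalIntegral.integral_of_le zero_le_one, integral_Ioc_eq_integral_Ioo,
      setIntegral_congr_fun measurableSet_Ioo this, ← integral_Ioc_eq_integral_Ioo,
      ← intervalIntegral.integral_of_le zero_le_one, intervalIntegral.integral_const_mul,
      intervalIntegral.integral_ofReal, integral_id]
    push_cast; ring
  have : ∀ r ∈ Set.Ioo (0:ℝ) 1, (r • ∫ θ in (0:ℝ)..2 * π,
      g (circleMap 0 r θ) / (1 - (starRingEnd ℂ) (circleMap 0 r θ) * z) ^ 2)
      = (π / z) * (deriv (fun w => w * g w) ((r:ℂ) ^ 2 * z) * (2 * r * z)) := by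
    intro r hr
    rw [angular g hg z hz r hr.1 hr.2, real_smul]; field_simp
  rw [intervalIntegral.integral_of_le zero_le_one, integral_Ioc_eq_integral_Ioo,
      setIntegral_congr_fun measurableSet_Ioo this, ← integral_Ioc_eq_integral_Ioo,
      ← intervalIntegral.integral_of_le zero_le_one, intervalIntegral.integral_const_mul]
  rw [intervalIntegral.integral_eq_sub_of_hasDerivAt
    (f := fun r : ℝ => ((r:ℂ) ^ 2 * z) * g ((r:ℂ) ^ 2 * z))]
  · simp; field_simp
  · intro r hr
    rw [Set.uIcc_of_le zero_le_one] at hr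
    have h1 : HasDerivAt (fun s : ℂ => s ^ 2 * z) (2 * r * z) (r:ℂ) := by
      simpa using (hasDerivAt_pow 2 (r:ℂ)).mul_const z
    have h2 := (hG.differentiableAt (isOpen_ball.mem_nhds (e r hr))).hasDerivAt
    exact (h2.comp (r:ℂ) h1).comp_ofReal
  · apply ContinuousOn.intervalIntegrable
    rw [Set.uIcc_of_le zero_le_one]
    refine ContinuousOn.mul (hd.continuousOn.comp (by fun_prop) e) (by fun_prop)

lemma int_inv (ζ : ℂ) : IntegrableOn (fun w : ℂ => (ζ - w)⁻¹) (closedBall 0 1) := by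
  have h0 : LocallyIntegrable (fun w : ℂ => w⁻¹) := by
    refine locallyIntegrable_of_norm_le_rpow (C := 1) (α := 1) (by simp) (by simp) ?_ ?_
    · refine Filter.Eventually.of_forall fun x => ?_
      rw [norm_inv, one_mul, Real.rpow_neg_one]
    · exact measurable_inv.aestronglyMeasurable
  have h1 := h0.integrableOn_isCompact ((isCompact_closedBall (ζ) 1))
  have h2 := (integrable_indicator_iff measurableSet_closedBall).2 h1
  have h3 := h2.comp_sub_left ζ
  rw [← integrable_indicator_iff measurableSet_closedBall]
  refine h3.congr (Filter.Eventually.of_forall fun w => ?_)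
  by_cases hw : ‖w‖ ≤ 1 <;> simp [Set.indicator, dist_eq_norm, hw]

lemma int_cont (ζ : ℂ) (h : ℂ → ℂ) (hh : ContinuousOn h (closedBall 0 1)) :
    IntegrableOn (fun w : ℂ => h w * (ζ - w)⁻¹) (ball 0 1) :=
  ((int_inv ζ).continuousOn_mul hh (isCompact_closedBall _ _)).mono_set ball_subset_closedBall

lemma re_P (ζ w : ℂ) (hζ : ‖ζ‖ = 1) :
    ((ζ + w) / (ζ - w)).re = (1 - ‖w‖ ^ 2) / ‖ζ - w‖ ^ 2 := by
  have h1 : ζ.re * ζ.re + ζ.im * ζ.im = 1 := by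
    rw [← Complex.normSq_apply, Complex.normSq_eq_norm_sq, hζ]; norm_num
  rw [Complex.div_re, ← Complex.normSq_eq_norm_sq, ← Complex.normSq_eq_norm_sq, ← add_div]
  congr 1
  rw [Complex.normSq_apply]
  simp only [add_re, sub_re, add_im, sub_im]
  linear_combination h1

theorem stmt_15 (ζ : ℂ) (hζ : ‖ζ‖ = 1) :
    ∀ z ∈ ball (0 : ℂ) 1,
      (1 - ‖z‖ ^ 2) *
        ‖((π : ℂ))⁻¹ * ∫ w in ball (0 : ℂ) 1,
            (((1 - ‖w‖ ^ 2) / ‖ζ - w‖ ^ 2 : ℝ) : ℂ) / (1 - (starRingEnd ℂ) w * z) ^ 2‖ ^ 2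
        = π⁻¹ * ∫ w in ball (0 : ℂ) 1,
            (1 - ‖z‖ ^ 2) ^ 2 / ‖1 - (starRingEnd ℂ) w * z‖ ^ 4 *
              ((1 - ‖w‖ ^ 2) / ‖ζ - w‖ ^ 2) := by
  intro z hz
  have hz : ‖z‖ < 1 := by simpa using hz
  have hne : ∀ w ∈ closedBall (0:ℂ) 1, 1 - (starRingEnd ℂ) w * z ≠ 0 := fun w hw =>
    one_sub_ne (by simpa using hw) hz
  have hne' : ∀ w ∈ closedBall (0:ℂ) 1, 1 - w * (starRingEnd ℂ) z ≠ 0 := by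
    intro w hw h
    apply hne w hw
    have := congrArg (starRingEnd ℂ) h
    simpa using this
  have hzw : ∀ w ∈ ball (0:ℂ) 1, ζ - w ≠ 0 := by
    intro w hw h
    rw [← sub_eq_zero.1 h] at hw
    simp [hζ] at hw
  have hzz := hzw z (by simpa using hz)
  have hcc : Continuous (starRingEnd ℂ) := Complex.continuous_conj
  have hP : DifferentiableOn ℂ (fun w => (ζ + w) / (ζ - w)) (ball 0 1) := by
    refine DifferentiableOn.div (by fun_prop) (by fun_prop) hzw
  have hg : DifferentiableOn ℂ
      (fun w => (ζ + w) / (ζ - w) / (1 - w * (starRingEnd ℂ) z) ^ 2) (ball 0 1) := by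
    refine hP.div (by fun_prop) fun w hw => pow_ne_zero 2 (hne' w (ball_subset_closedBall hw))
  have cA : ContinuousOn (fun w : ℂ => (ζ + w) / (1 - (starRingEnd ℂ) w * z) ^ 2)
      (closedBall 0 1) :=
    ContinuousOn.div (by fun_prop) (by fun_prop) fun w hw => pow_ne_zero 2 (hne w hw)
  have cB : ContinuousOn (fun w : ℂ => (ζ + w) / (1 - w * (starRingEnd ℂ) z) ^ 2)
      (closedBall 0 1) :=
    ContinuousOn.div (by fun_prop) (by fun_prop) fun w hw => pow_ne_zero 2 (hne' w hw)
  have cC : ContinuousOn (fun w : ℂ => (ζ + w) / (1 - w * (starRingEnd ℂ) z) ^ 2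
      / (1 - (starRingEnd ℂ) w * z) ^ 2) (closedBall 0 1) :=
    cB.div (by fun_prop) fun w hw => pow_ne_zero 2 (hne w hw)
  have iA : IntegrableOn (fun w => (ζ + w) / (ζ - w) / (1 - (starRingEnd ℂ) w * z) ^ 2)
      (ball 0 1) := by
    refine (int_cont ζ _ cA).congr_fun (fun w _ => ?_) measurableSet_ball
    simp only [div_eq_mul_inv]; ring
  have iB : IntegrableOn (fun w => (ζ + w) / (ζ - w) / (1 - w * (starRingEnd ℂ) z) ^ 2)
      (ball 0 1) := by
    refine (int_cont ζ _ cB).congr_fun (fun w _ => ?_) measurableSet_ball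
    simp only [div_eq_mul_inv]; ring
  have iC : IntegrableOn (fun w => (ζ + w) / (ζ - w) / (1 - w * (starRingEnd ℂ) z) ^ 2
      / (1 - (starRingEnd ℂ) w * z) ^ 2) (ball 0 1) := by
    refine (int_cont ζ _ cC).congr_fun (fun w _ => ?_) measurableSet_ball
    simp only [div_eq_mul_inv]; ring
  have rA := reproduce _ hP z hz iA
  have rB := reproduce _ hg 0 (by simp) (by simpa using iB)
  have rC := reproduce _ hg z hz iC
  have hζ0 : ζ ≠ 0 := by rw [← norm_pos_iff, hζ]; norm_num
  simp only [mul_zero, sub_zero, one_pow, div_one, add_zero, zero_mul, div_self hζ0, mul_one] at rB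
  have hpi : (π : ℂ) ≠ 0 := by exact_mod_cast pi_ne_zero
  have iB' : IntegrableOn (fun w => (starRingEnd ℂ)
      ((ζ + w) / (ζ - w) / (1 - w * (starRingEnd ℂ) z) ^ 2)) (ball 0 1) :=
    (Complex.conjCLE.toContinuousLinearMap.integrable_comp iB)
  have hQ : ∫ w in ball (0 : ℂ) 1,
      (((1 - ‖w‖ ^ 2) / ‖ζ - w‖ ^ 2 : ℝ) : ℂ) / (1 - (starRingEnd ℂ) w * z) ^ 2
      = π * (ζ / (ζ - z)) := by
    have : ∀ w ∈ ball (0:ℂ) 1,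
        (((1 - ‖w‖ ^ 2) / ‖ζ - w‖ ^ 2 : ℝ) : ℂ) / (1 - (starRingEnd ℂ) w * z) ^ 2
        = (1 / 2) * ((ζ + w) / (ζ - w) / (1 - (starRingEnd ℂ) w * z) ^ 2
          + (starRingEnd ℂ) ((ζ + w) / (ζ - w) / (1 - w * (starRingEnd ℂ) z) ^ 2)) := by
      intro w _
      rw [← re_P ζ w hζ, Complex.re_eq_add_conj, map_div₀ (starRingEnd ℂ) ((ζ + w) / (ζ - w))]
      simp only [map_pow, map_sub, map_one, map_mul, Complex.conj_conj]
      ring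
    rw [setIntegral_congr_fun measurableSet_ball this, integral_const_mul,
      integral_add iA iB', rA, integral_conj, rB, Complex.conj_ofReal]
    field_simp
    ring
  have hB : ∫ w in ball (0 : ℂ) 1, (1 - ‖z‖ ^ 2) ^ 2 / ‖1 - (starRingEnd ℂ) w * z‖ ^ 4 *
              ((1 - ‖w‖ ^ 2) / ‖ζ - w‖ ^ 2) = π * ((1 - ‖z‖ ^ 2) / ‖ζ - z‖ ^ 2) := by
    have : ∀ w ∈ ball (0:ℂ) 1, (1 - ‖z‖ ^ 2) ^ 2 / ‖1 - (starRingEnd ℂ) w * z‖ ^ 4 *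
              ((1 - ‖w‖ ^ 2) / ‖ζ - w‖ ^ 2)
        = (1 - ‖z‖ ^ 2) ^ 2 * ((ζ + w) / (ζ - w) / (1 - w * (starRingEnd ℂ) z) ^ 2
            / (1 - (starRingEnd ℂ) w * z) ^ 2).re := by
      intro w _
      have e : (1 - w * (starRingEnd ℂ) z) ^ 2 * (1 - (starRingEnd ℂ) w * z) ^ 2
          = ((‖1 - (starRingEnd ℂ) w * z‖ ^ 4 : ℝ) : ℂ) := by
        have h := Complex.mul_conj (1 - (starRingEnd ℂ) w * z)
        rw [Complex.normSq_eq_norm_sq] at h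
        simp only [map_sub, map_one, map_mul, Complex.conj_conj] at h
        rw [← mul_pow, mul_comm, h]
        push_cast; ring
      rw [div_div _ ((1 - w * (starRingEnd ℂ) z) ^ 2), e, Complex.div_ofReal_re, re_P ζ w hζ]
      ring
    have hre := Complex.reCLM.integral_comp_comm iC
    simp only [Complex.reCLM_apply] at hre
    rw [setIntegral_congr_fun measurableSet_ball this, integral_const_mul, hre, rC]
    have e2 : (1 - z * (starRingEnd ℂ) z) ^ 2 = (((1 - ‖z‖ ^ 2) ^ 2 : ℝ) : ℂ) := by
      rw [Complex.mul_conj, Complex.normSq_eq_norm_sq]; push_cast; rfl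
    rw [e2, Complex.re_ofReal_mul, Complex.div_ofReal_re, re_P ζ z hζ]
    have : (1 - ‖z‖ ^ 2) ≠ 0 := by nlinarith [norm_nonneg z]
    have h3 : ‖ζ - z‖ ≠ 0 := norm_ne_zero_iff.2 hzz
    field_simp
  rw [hQ, hB, ← mul_assoc, ← mul_assoc, inv_mul_cancel₀ hpi, inv_mul_cancel₀ pi_ne_zero, one_mul,
    one_mul, norm_div, hζ, div_pow]
  ring
end

section
/- Let b ∈ H^∞ with ‖b‖_∞ ≤ 1 be non-extreme with pair (b, a) (a outer, a(0) > 0, |a|² + |b|² = 1 a.e. on 𝕋), and let φ = b/a. For f ∈ H(b) with T_{conj(b)} f = T_{conj(a)} f⁺, and 0 ≤ r < 1, if φ_r/φ extends to a bounded holomorphic function on 𝔻, then ‖(f_r)⁺‖_{H²} ≤ ‖φ_r/φ‖_{H^∞} · ‖f⁺‖_{H²}, where f_r(z) = f(rz). -/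
open Complex Metric MeasureTheory Real Filter

/-- `n`-th Taylor coefficient at `0` of a function holomorphic on the unit disk. -/
noncomputable def hcoeff (f : ℂ → ℂ) (n : ℕ) : ℂ := iteratedDeriv n f 0 / (n.factorial : ℂ)

/-- Membership in the Hardy space `H²` of the unit disk: holomorphic on `𝔻` with
square-summable Taylor coefficients. -/
def MemH2 (f : ℂ → ℂ) : Prop :=
  DifferentiableOn ℂ f (Metric.ball (0 : ℂ) 1) ∧ Summable fun n : ℕ => ‖hcoeff f n‖ ^ 2

/-- The `H²` inner product, conjugate-linear in the first argument. -/
noncomputable def h2inner (f g : ℂ → ℂ) : ℂ :=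
  ∑' n : ℕ, (starRingEnd ℂ) (hcoeff f n) * hcoeff g n


lemma hcoeff_congr {f g : ℂ → ℂ} (h : ∀ z ∈ ball (0 : ℂ) 1, f z = g z) (n : ℕ) :
    hcoeff f n = hcoeff g n := by
  unfold hcoeff
  have : f =ᶠ[nhds 0] g := by
    filter_upwards [Metric.ball_mem_nhds (0 : ℂ) one_pos] with z hz using h z hz
  rw [this.iteratedDeriv_eq n]

lemma contDiffAt_of_ball {f : ℂ → ℂ} (hf : DifferentiableOn ℂ f (ball (0 : ℂ) 1)) (n : ℕ) :
    ContDiffAt ℂ n f 0 :=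
  (hf.analyticAt (Metric.ball_mem_nhds (0 : ℂ) one_pos)).contDiffAt

lemma hcoeff_sub {f g : ℂ → ℂ} (hf : DifferentiableOn ℂ f (ball (0 : ℂ) 1))
    (hg : DifferentiableOn ℂ g (ball (0 : ℂ) 1)) (n : ℕ) :
    hcoeff (fun z => f z - g z) n = hcoeff f n - hcoeff g n := by
  unfold hcoeff
  rw [iteratedDeriv_fun_sub (contDiffAt_of_ball hf n) (contDiffAt_of_ball hg n), sub_div]

lemma mapsTo_dil {r : ℝ} (hr0 : 0 ≤ r) (hr1 : r < 1) :
    Set.MapsTo (fun z : ℂ => (r : ℂ) * z) (ball (0 : ℂ) 1) (ball (0 : ℂ) 1) := by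
  intro z hz
  simp only [mem_ball_zero_iff, norm_mul, Complex.norm_real, Real.norm_eq_abs,
    abs_of_nonneg hr0] at hz ⊢
  nlinarith [norm_nonneg z]

lemma hcoeff_dil {f : ℂ → ℂ} (hf : DifferentiableOn ℂ f (ball (0 : ℂ) 1)) {r : ℝ}
    (hr0 : 0 ≤ r) (hr1 : r < 1) (n : ℕ) :
    hcoeff (fun z => f ((r : ℂ) * z)) n = (r : ℂ) ^ n * hcoeff f n := by
  unfold hcoeff
  have h0 : (0 : ℂ) ∈ ball (0 : ℂ) 1 := by simp
  have hc : ContDiffOn ℂ n f (ball (0 : ℂ) 1) := hf.contDiffOn isOpen_ball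
  have := iteratedDerivWithin_comp_const_smul (x := 0) h0 isOpen_ball.uniqueDiffOn hc (r : ℂ)
    (mapsTo_dil hr0 hr1)
  rw [mul_zero, iteratedDerivWithin_of_isOpen isOpen_ball h0,
    iteratedDerivWithin_of_isOpen isOpen_ball h0] at this
  rw [this, smul_eq_mul, mul_div_assoc]

lemma hasSum_hcoeff {f : ℂ → ℂ} (hf : DifferentiableOn ℂ f (ball (0 : ℂ) 1)) {z : ℂ}
    (hz : z ∈ ball (0 : ℂ) 1) : HasSum (fun n => hcoeff f n * z ^ n) (f z) := by
  have := Complex.hasSum_taylorSeries_on_ball hf hz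
  have e : (fun n => hcoeff f n * z ^ n) =
      fun n : ℕ => (n.factorial : ℂ)⁻¹ • (z - 0) ^ n • iteratedDeriv n f 0 := by
    ext n
    simp only [hcoeff, sub_zero, smul_eq_mul, div_eq_mul_inv]
    ring
  rw [e]; exact this
  

lemma parseval {F : ℂ → ℂ} (hF : DifferentiableOn ℂ F (ball (0 : ℂ) 1)) {s : ℝ}
    (hs0 : 0 ≤ s) (hs1 : s < 1) :
    ∃ v : C(AddCircle (1 : ℝ), ℂ),
      (∀ x, v x = F ((s : ℂ) * AddCircle.toCircle x)) ∧
      HasSum (fun n : ℕ => ‖hcoeff F n * (s : ℂ) ^ n‖ ^ 2)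
        (‖ContinuousMap.toLp (E := ℂ) 2 AddCircle.haarAddCircle ℂ v‖ ^ 2) := by
  have hs : (s : ℂ) ∈ ball (0 : ℂ) 1 := by simpa [abs_of_nonneg hs0] using hs1
  have hsum : Summable (fun n => ‖hcoeff F n * (s : ℂ) ^ n‖) := (hasSum_hcoeff hF hs).summable.norm
  have hS : Summable (fun n : ℕ => (hcoeff F n * (s : ℂ) ^ n) • (fourier (n : ℤ) : C(AddCircle (1 : ℝ), ℂ))) := by
    apply Summable.of_norm
    simpa only [norm_smul, fourier_norm, mul_one] using hsum
  obtain ⟨v, hv⟩ := hS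
  refine ⟨v, fun x => ?_, ?_⟩
  · have h1 := (ContinuousMap.evalCLM ℂ x).hasSum hv
    have hx : (s : ℂ) * AddCircle.toCircle x ∈ ball (0 : ℂ) 1 := by
      simpa [abs_of_nonneg hs0, Circle.norm_coe] using hs1
    have h2 := hasSum_hcoeff hF hx
    refine HasSum.unique h1 ?_
    convert h2 using 2 with n
    simp [fourier_apply, AddCircle.toCircle_nsmul, mul_pow, mul_assoc]
  · have h1 := (ContinuousMap.toLp (E := ℂ) 2 AddCircle.haarAddCircle ℂ).hasSum hv
    have ho : Orthonormal ℂ (fun n : ℕ => fourierLp (T := 1) 2 (n : ℤ)) :=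
      (orthonormal_fourier (T := 1)).comp _ Nat.cast_injective
    have h2 : Tendsto _ _ _ := (Filter.Tendsto.norm h1).pow 2
    refine h2.congr fun t => ?_
    have h3 := ho.inner_sum (fun n => hcoeff F n * (s : ℂ) ^ n) (fun n => hcoeff F n * (s : ℂ) ^ n) t
    rw [inner_self_eq_norm_sq_to_K] at h3
    simp only [map_smul]
    simp only [Complex.conj_mul'] at h3
    apply Complex.ofReal_injective
    rw [Complex.ofReal_pow, Complex.ofReal_sum]
    simp only [Complex.ofReal_pow]
    exact h3

lemma mul_bound {F u : ℂ → ℂ} {M : ℝ} (hM : 0 ≤ M) (hF : DifferentiableOn ℂ F (ball (0 : ℂ) 1))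
    (hb : ∀ z ∈ ball (0 : ℂ) 1, ‖F z‖ ≤ M) (hu : MemH2 u) :
    MemH2 (fun z => F z * u z) ∧
    ∑' n, ‖hcoeff (fun z => F z * u z) n‖ ^ 2 ≤ M ^ 2 * ∑' n, ‖hcoeff u n‖ ^ 2 := by
  have hd : DifferentiableOn ℂ (fun z => F z * u z) (ball (0 : ℂ) 1) := hF.mul hu.1
  have key : ∀ t : Finset ℕ, ∑ n ∈ t, ‖hcoeff (fun z => F z * u z) n‖ ^ 2
      ≤ M ^ 2 * ∑' n, ‖hcoeff u n‖ ^ 2 := by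
    intro t
    have hs : ∀ s : ℝ, s ∈ Set.Ico 0 1 →
        ∑ n ∈ t, ‖hcoeff (fun z => F z * u z) n * (s : ℂ) ^ n‖ ^ 2
          ≤ M ^ 2 * ∑' n, ‖hcoeff u n‖ ^ 2 := by
      rintro s ⟨hs0, hs1⟩
      obtain ⟨v, hv, hvs⟩ := parseval hu.1 hs0 hs1
      obtain ⟨w, hw, hws⟩ := parseval hd hs0 hs1
      refine (sum_le_hasSum t (fun _ _ => by positivity) hws).trans ?_
      have h1 : ‖ContinuousMap.toLp (E := ℂ) 2 AddCircle.haarAddCircle ℂ w‖ ≤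
          M * ‖ContinuousMap.toLp (E := ℂ) 2 AddCircle.haarAddCircle ℂ v‖ := by
        apply Lp.norm_le_mul_norm_of_ae_le_mul
        filter_upwards [ContinuousMap.coeFn_toLp (p := 2) (𝕜 := ℂ) AddCircle.haarAddCircle w,
          ContinuousMap.coeFn_toLp (p := 2) (𝕜 := ℂ) AddCircle.haarAddCircle v] with x hx1 hx2
        rw [hx1, hx2, hv, hw, norm_mul]
        refine mul_le_mul_of_nonneg_right (hb _ ?_) (norm_nonneg _)
        simpa [abs_of_nonneg hs0, Circle.norm_coe] using hs1
      have h2 : ‖ContinuousMap.toLp (E := ℂ) 2 AddCircle.haarAddCircle ℂ v‖ ^ 2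
          ≤ ∑' n, ‖hcoeff u n‖ ^ 2 := by
        rw [← hvs.tsum_eq]
        refine hvs.summable.tsum_le_tsum (fun n => ?_) hu.2
        gcongr
        rw [norm_mul, norm_pow, Complex.norm_real, Real.norm_of_nonneg hs0]
        exact mul_le_of_le_one_right (norm_nonneg _) (pow_le_one₀ hs0 hs1.le)
      calc _ ≤ (M * ‖ContinuousMap.toLp (E := ℂ) 2 AddCircle.haarAddCircle ℂ v‖) ^ 2 := by gcongr
        _ = M ^ 2 * ‖ContinuousMap.toLp (E := ℂ) 2 AddCircle.haarAddCircle ℂ v‖ ^ 2 := by ring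
        _ ≤ _ := by gcongr
    have hc : Continuous (fun s : ℝ =>
        ∑ n ∈ t, ‖hcoeff (fun z => F z * u z) n * (s : ℂ) ^ n‖ ^ 2) := by fun_prop
    have h1 : (1 : ℝ) ∈ closure (Set.Ico (0 : ℝ) 1) := by
      rw [closure_Ico (by norm_num)]; simp
    have h2 : ∑ n ∈ t, ‖hcoeff (fun z => F z * u z) n * ((1 : ℝ) : ℂ) ^ n‖ ^ 2
          ≤ M ^ 2 * ∑' n, ‖hcoeff u n‖ ^ 2 :=
      closure_minimal (s := Set.Ico (0 : ℝ) 1) hs (isClosed_le hc continuous_const) h1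
    simpa using h2
  have hsm : Summable fun n => ‖hcoeff (fun z => F z * u z) n‖ ^ 2 :=
    summable_of_sum_le (fun _ => by positivity) key
  exact ⟨⟨hd, hsm⟩, hsm.tsum_le_of_sum_le key⟩

/-- Coefficient vector in `ℓ²`. -/
noncomputable def vec (f : ℂ → ℂ) (hf : MemH2 f) : lp (fun _ : ℕ => ℂ) 2 :=
  ⟨hcoeff f, by
    show Memℓp (hcoeff f) 2
    rw [memℓp_gen_iff (by norm_num)]
    simpa using hf.2⟩

lemma vec_inner {f g : ℂ → ℂ} (hf : MemH2 f) (hg : MemH2 g) :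
    h2inner f g = inner ℂ (vec f hf) (vec g hg) := by
  rw [lp.inner_eq_tsum]
  simp only [vec, h2inner, RCLike.inner_apply, mul_comm]

lemma vec_norm {f : ℂ → ℂ} (hf : MemH2 f) : ‖vec f hf‖ ^ 2 = ∑' n, ‖hcoeff f n‖ ^ 2 := by
  have := lp.norm_rpow_eq_tsum (p := 2) (by norm_num) (vec f hf)
  simpa [vec] using this

lemma vec_norm' {f : ℂ → ℂ} (hf : MemH2 f) : ‖vec f hf‖ = √(∑' n, ‖hcoeff f n‖ ^ 2) := by
  rw [← vec_norm hf, Real.sqrt_sq (norm_nonneg _)]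

lemma vec_mul {F u : ℂ → ℂ} {M : ℝ} (hM : 0 ≤ M) (hF : DifferentiableOn ℂ F (ball (0 : ℂ) 1))
    (hb : ∀ z ∈ ball (0 : ℂ) 1, ‖F z‖ ≤ M) (hu : MemH2 u) (h : MemH2 (fun z => F z * u z)) :
    ‖vec _ h‖ ≤ M * ‖vec u hu‖ := by
  have := (mul_bound hM hF hb hu).2
  rw [← vec_norm hu, ← vec_norm h, ← mul_pow] at this
  exact (sq_le_sq₀ (norm_nonneg _) (by positivity)).1 this

lemma vec_sub {f g : ℂ → ℂ} (hf : MemH2 f) (hg : MemH2 g) (h : MemH2 (fun z => f z - g z)) :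
    vec _ h = vec f hf - vec g hg := by
  ext n
  exact hcoeff_sub hf.1 hg.1 n

lemma memH2_dil {f : ℂ → ℂ} (hf : MemH2 f) {r : ℝ} (hr0 : 0 ≤ r) (hr1 : r < 1) :
    MemH2 (fun z => f ((r : ℂ) * z)) ∧
    ∀ h : MemH2 (fun z => f ((r : ℂ) * z)), ‖vec _ h‖ ≤ ‖vec f hf‖ := by
  have hle : ∀ n, ‖hcoeff (fun z => f ((r : ℂ) * z)) n‖ ^ 2 ≤ ‖hcoeff f n‖ ^ 2 := by
    intro n
    rw [hcoeff_dil hf.1 hr0 hr1, norm_mul, norm_pow, Complex.norm_real, Real.norm_of_nonneg hr0]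
    gcongr
    exact mul_le_of_le_one_left (norm_nonneg _) (pow_le_one₀ hr0 hr1.le)
  have hm : MemH2 (fun z => f ((r : ℂ) * z)) :=
    ⟨hf.1.comp (by fun_prop) (mapsTo_dil hr0 hr1), hf.2.of_nonneg_of_le (fun _ => by positivity) hle⟩
  refine ⟨hm, fun h => ?_⟩
  rw [vec_norm', vec_norm']
  exact Real.sqrt_le_sqrt (h.2.tsum_le_tsum hle hf.2)

lemma bdd_dil {f : ℂ → ℂ} (hf : DifferentiableOn ℂ f (ball (0 : ℂ) 1)) {r : ℝ}
    (hr0 : 0 ≤ r) (hr1 : r < 1) :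
    ∃ C : ℝ, 0 ≤ C ∧ ∀ z ∈ ball (0 : ℂ) 1, ‖f ((r : ℂ) * z)‖ ≤ C := by
  have hc : ContinuousOn f (closedBall (0 : ℂ) r) :=
    hf.continuousOn.mono (closedBall_subset_ball hr1)
  obtain ⟨C, hC⟩ := (isCompact_closedBall (0 : ℂ) r).exists_bound_of_continuousOn hc
  have hC' : ∀ z ∈ ball (0 : ℂ) 1, ‖f ((r : ℂ) * z)‖ ≤ C := by
    intro z hz
    apply hC
    simp only [mem_ball_zero_iff, mem_closedBall_zero_iff, norm_mul, Complex.norm_real,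
      Real.norm_of_nonneg hr0] at hz ⊢
    exact mul_le_of_le_one_right hr0 hz.le
  exact ⟨C, (norm_nonneg _).trans (hC' 0 (by simp)), hC'⟩

lemma memH2_congr {f g : ℂ → ℂ} (hg : MemH2 g) (h : ∀ z ∈ ball (0 : ℂ) 1, f z = g z) : MemH2 f :=
  ⟨hg.1.congr h, by simpa only [hcoeff_congr h] using hg.2⟩

lemma h2inner_dil {f g : ℂ → ℂ} (hf : DifferentiableOn ℂ f (ball (0 : ℂ) 1))
    (hg : DifferentiableOn ℂ g (ball (0 : ℂ) 1)) {r : ℝ} (hr0 : 0 ≤ r) (hr1 : r < 1) :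
    h2inner f (fun z => g ((r : ℂ) * z)) = h2inner (fun z => f ((r : ℂ) * z)) g := by
  unfold h2inner
  congr 1; ext n
  rw [hcoeff_dil hf hr0 hr1, hcoeff_dil hg hr0 hr1]
  simp
  ring

lemma memH2_one : MemH2 (fun _ => 1) := by
  refine ⟨differentiableOn_const _, summable_of_ne_finset_zero (s := {0}) fun n hn => ?_⟩
  have : n ≠ 0 := by simpa using hn
  simp [hcoeff, iteratedDeriv_const, this]

lemma norm_le_of_dense {v : lp (fun _ : ℕ => ℂ) 2} {K : ℝ} (hK : 0 ≤ K)
    (h : ∀ δ : ℝ, 0 < δ → ∃ x : lp (fun _ : ℕ => ℂ) 2, ‖v - x‖ < δ ∧ ‖inner ℂ x v‖ ≤ K * ‖x‖) :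
    ‖v‖ ≤ K := by
  have hcl : IsClosed {x : lp (fun _ : ℕ => ℂ) 2 | ‖inner ℂ x v‖ ≤ K * ‖x‖} :=
    isClosed_le (by fun_prop) (by fun_prop)
  have hv : v ∈ closure {x : lp (fun _ : ℕ => ℂ) 2 | ‖inner ℂ x v‖ ≤ K * ‖x‖} := by
    rw [Metric.mem_closure_iff]
    intro δ hδ
    obtain ⟨x, hx1, hx2⟩ := h δ hδ
    exact ⟨x, hx2, by rwa [dist_eq_norm]⟩
  rw [hcl.closure_eq] at hv
  have h1 : ‖inner ℂ v v‖ ≤ K * ‖v‖ := hv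
  rw [inner_self_eq_norm_sq_to_K] at h1
  have h2 : ‖v‖ ^ 2 ≤ K * ‖v‖ := by simpa using h1
  rcases (norm_nonneg v).eq_or_lt with h0 | h0
  · rwa [← h0]
  · nlinarith

lemma vec_congr {f g : ℂ → ℂ} (hf : MemH2 f) (hg : MemH2 g)
    (h : ∀ z ∈ ball (0 : ℂ) 1, f z = g z) : vec f hf = vec g hg := by
  ext n
  exact hcoeff_congr h n

/-- Let `(b,a)` be a pair (`a` outer with `a(0) > 0` and `|a|² + |b|² = 1` a.e. on `𝕋`,
the latter via radial limits, outerness via density of `aH²` in `H²`), `φ = b/a`, and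
`f ∈ H(b)`, i.e. `T_{conj b} f = T_{conj a} f⁺` (expressed by testing inner products
against `bg`, `ag` for `g ∈ H²`). If `φ_r/φ` extends to a bounded holomorphic `G` on `𝔻`,
then `‖(f_r)⁺‖_{H²} ≤ ‖φ_r/φ‖_{H^∞} ‖f⁺‖_{H²}`, where `f_r(z) = f(rz)`. -/
theorem stmt_16 (b a : ℂ → ℂ)
    (hbhol : DifferentiableOn ℂ b (ball (0 : ℂ) 1))
    (hbnorm : ∀ z ∈ ball (0 : ℂ) 1, ‖b z‖ ≤ 1)
    (hahol : DifferentiableOn ℂ a (ball (0 : ℂ) 1))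
    (hanorm : ∀ z ∈ ball (0 : ℂ) 1, ‖a z‖ ≤ 1)
    (ha0 : 0 < (a 0).re ∧ (a 0).im = 0)
    (hpair : ∀ᵐ θ ∂(volume.restrict (Set.Ioc (0 : ℝ) (2 * π))),
      Tendsto (fun r : ℝ =>
          ‖a ((r : ℂ) * circleMap 0 1 θ)‖ ^ 2 + ‖b ((r : ℂ) * circleMap 0 1 θ)‖ ^ 2)
        (nhdsWithin 1 (Set.Iio 1)) (nhds 1))
    (houter : ∀ f : ℂ → ℂ, MemH2 f → ∀ ε : ℝ, 0 < ε → ∃ h : ℂ → ℂ, MemH2 h ∧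
      MemH2 (fun z => f z - a z * h z) ∧
      (∑' n : ℕ, ‖hcoeff (fun z => f z - a z * h z) n‖ ^ 2) < ε)
    (r : ℝ) (hr0 : 0 ≤ r) (hr1 : r < 1)
    (f fplus frplus : ℂ → ℂ)
    (hf : MemH2 f) (hfplus : MemH2 fplus) (hfrplus : MemH2 frplus)
    (hrel : ∀ g : ℂ → ℂ, MemH2 g →
      h2inner (fun z => b z * g z) f = h2inner (fun z => a z * g z) fplus)
    (hrelr : ∀ g : ℂ → ℂ, MemH2 g →
      h2inner (fun z => b z * g z) (fun z => f ((r : ℂ) * z))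
        = h2inner (fun z => a z * g z) frplus)
    (G : ℂ → ℂ) (hGhol : DifferentiableOn ℂ G (ball (0 : ℂ) 1))
    (hGbdd : BddAbove ((fun z => ‖G z‖) '' ball (0 : ℂ) 1))
    (hGφ : ∀ z ∈ ball (0 : ℂ) 1,
      G z * b z * a ((r : ℂ) * z) = b ((r : ℂ) * z) * a z) :
    Real.sqrt (∑' n : ℕ, ‖hcoeff frplus n‖ ^ 2)
      ≤ sSup ((fun z => ‖G z‖) '' ball (0 : ℂ) 1) *
          Real.sqrt (∑' n : ℕ, ‖hcoeff fplus n‖ ^ 2) := by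
  set M := sSup ((fun z => ‖G z‖) '' ball (0 : ℂ) 1) with hMdef
  have hGM : ∀ z ∈ ball (0 : ℂ) 1, ‖G z‖ ≤ M := fun z hz => le_csSup hGbdd ⟨z, hz, rfl⟩
  have hM : 0 ≤ M := (norm_nonneg _).trans (hGM 0 (by simp))
  have hmaps := mapsTo_dil hr0 hr1
  -- density of `aH²` in terms of norms
  have hdense : ∀ (w : ℂ → ℂ), MemH2 w → ∀ δ : ℝ, 0 < δ → ∃ k, MemH2 k ∧
      ∃ h : MemH2 (fun z => w z - a z * k z), ‖vec _ h‖ < δ := by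
    intro w hw δ hδ
    obtain ⟨k, hk, h, hlt⟩ := houter w hw (δ ^ 2) (by positivity)
    refine ⟨k, hk, h, ?_⟩
    rw [← vec_norm h] at hlt
    exact lt_of_pow_lt_pow_left₀ 2 hδ.le hlt
  -- transfer of the relation
  have htrans : ∀ h : ℂ → ℂ, MemH2 h →
      h2inner (fun z => b ((r : ℂ) * z) * h ((r : ℂ) * z)) f =
        h2inner (fun z => G z * (a ((r : ℂ) * z) * h ((r : ℂ) * z))) fplus := by
    intro h hh
    obtain ⟨C, hC0, hC⟩ := bdd_dil hh.1 hr0 hr1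
    have hhr : DifferentiableOn ℂ (fun z => h ((r : ℂ) * z)) (ball (0 : ℂ) 1) :=
      hh.1.comp (by fun_prop) hmaps
    have har : DifferentiableOn ℂ (fun z => a ((r : ℂ) * z)) (ball (0 : ℂ) 1) :=
      hahol.comp (by fun_prop) hmaps
    have hbr : DifferentiableOn ℂ (fun z => b ((r : ℂ) * z)) (ball (0 : ℂ) 1) :=
      hbhol.comp (by fun_prop) hmaps
    set P : ℂ → ℂ := fun z => b ((r : ℂ) * z) * h ((r : ℂ) * z) with hPdef
    set U : ℂ → ℂ := fun z => G z * (a ((r : ℂ) * z) * h ((r : ℂ) * z)) with hUdef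
    have hPd : DifferentiableOn ℂ P (ball (0 : ℂ) 1) := hbr.mul hhr
    have hUd : DifferentiableOn ℂ U (ball (0 : ℂ) 1) := hGhol.mul (har.mul hhr)
    have hPb : ∀ z ∈ ball (0 : ℂ) 1, ‖P z‖ ≤ C := by
      intro z hz
      rw [hPdef]
      simp only [norm_mul]
      calc _ ≤ 1 * C := mul_le_mul (hbnorm _ (hmaps hz)) (hC z hz) (norm_nonneg _) zero_le_one
        _ = C := one_mul C
    have hUb : ∀ z ∈ ball (0 : ℂ) 1, ‖U z‖ ≤ M * C := by
      intro z hz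
      rw [hUdef]
      simp only [norm_mul]
      refine mul_le_mul (hGM z hz) ?_ (by positivity) hM
      calc _ ≤ 1 * C := mul_le_mul (hanorm _ (hmaps hz)) (hC z hz) (norm_nonneg _) zero_le_one
        _ = C := one_mul C
    have hMC : 0 ≤ M * C := mul_nonneg hM hC0
    have hP : MemH2 P := memH2_congr (mul_bound hC0 hPd hPb memH2_one).1 (fun z _ => by simp)
    have hU : MemH2 U := memH2_congr (mul_bound hMC hUd hUb memH2_one).1 (fun z _ => by simp)
    rw [← sub_eq_zero, ← norm_le_zero_iff]
    set D := C * ‖vec f hf‖ + M * C * ‖vec fplus hfplus‖ with hD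
    have hD0 : 0 ≤ D := by positivity
    have hsmall : ∀ δ : ℝ, 0 < δ → ‖h2inner P f - h2inner U fplus‖ ≤ D * δ := by
      intro δ hδ
      obtain ⟨k, hk, h1, hlt⟩ := hdense _ memH2_one δ hδ
      have hg : MemH2 (fun z => U z * k z) := (mul_bound hMC hUd hUb hk).1
      have hbg := (mul_bound zero_le_one hbhol hbnorm hg).1
      have hag := (mul_bound zero_le_one hahol hanorm hg).1
      have eP : ∀ z ∈ ball (0 : ℂ) 1,
          P z - b z * (U z * k z) = P z * (1 - a z * k z) := by
        intro z hz
        have := hGφ z hz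
        simp only [hPdef, hUdef]
        linear_combination (-(h (r * z)) * k z) * this
      have eU : ∀ z ∈ ball (0 : ℂ) 1,
          U z - a z * (U z * k z) = U z * (1 - a z * k z) := by
        intro z hz
        ring
      have hP1 := (mul_bound hC0 hPd hPb h1).1
      have hU1 := (mul_bound hMC hUd hUb h1).1
      have hP2 := memH2_congr hP1 eP
      have hU2 := memH2_congr hU1 eU
      have nP : ‖vec P hP - vec _ hbg‖ ≤ C * δ := by
        rw [← vec_sub hP hbg hP2, vec_congr hP2 hP1 eP]
        exact (vec_mul hC0 hPd hPb h1 hP1).trans (by gcongr)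
      have nU : ‖vec U hU - vec _ hag‖ ≤ M * C * δ := by
        rw [← vec_sub hU hag hU2, vec_congr hU2 hU1 eU]
        exact (vec_mul hMC hUd hUb h1 hU1).trans (by gcongr)
      have hr := hrel _ hg
      rw [vec_inner hbg hf, vec_inner hag hfplus] at hr
      rw [vec_inner hP hf, vec_inner hU hfplus]
      have e : inner ℂ (vec P hP) (vec f hf) - inner ℂ (vec U hU) (vec fplus hfplus) =
          inner ℂ (vec P hP - vec _ hbg) (vec f hf)
            - inner ℂ (vec U hU - vec _ hag) (vec fplus hfplus) := by
        rw [inner_sub_left, inner_sub_left, hr]; ring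
      rw [e]
      calc _ ≤ _ := norm_sub_le _ _
        _ ≤ ‖vec P hP - vec _ hbg‖ * ‖vec f hf‖ + ‖vec U hU - vec _ hag‖ * ‖vec fplus hfplus‖ :=
          add_le_add (norm_inner_le_norm _ _) (norm_inner_le_norm _ _)
        _ ≤ C * δ * ‖vec f hf‖ + M * C * δ * ‖vec fplus hfplus‖ := by gcongr
        _ = D * δ := by rw [hD]; ring
    refine le_of_forall_pos_le_add fun ε hε => ?_
    refine (hsmall (ε / (D + 1)) (by positivity)).trans ?_
    rw [zero_add, ← mul_div_assoc, div_le_iff₀ (by positivity)]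
    nlinarith
  rw [← vec_norm' hfrplus, ← vec_norm' hfplus]
  refine norm_le_of_dense (by positivity) fun δ hδ => ?_
  obtain ⟨h, hh, h1, hlt⟩ := hdense _ hfrplus δ hδ
  have hah := (mul_bound zero_le_one hahol hanorm hh).1
  have hbh := (mul_bound zero_le_one hbhol hbnorm hh).1
  refine ⟨vec _ hah, ?_, ?_⟩
  · rwa [← vec_sub hfrplus hah h1]
  · obtain ⟨hahr, hle⟩ := memH2_dil hah hr0 hr1
    have hW := (mul_bound hM hGhol hGM hahr).1
    rw [← vec_inner hah hfrplus, ← hrelr h hh, h2inner_dil hbh.1 hf.1 hr0 hr1, htrans h hh,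
      vec_inner hW hfplus]
    calc _ ≤ ‖vec _ hW‖ * ‖vec fplus hfplus‖ := norm_inner_le_norm _ _
      _ ≤ (M * ‖vec _ hah‖) * ‖vec fplus hfplus‖ := by
        gcongr
        exact (vec_mul hM hGhol hGM hahr hW).trans (by gcongr; exact hle hahr)
      _ = _ := by ring
end
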